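/- Any singular linear form ρ : CS_c.c(ℝⁿ) → ℂ (n ≥ 2) with Stokes' property is proportional to the noncommutative residue: there exists a constant c ∈ ℂ such that ρ(σ) = c·res(σ) for every classical symbol σ with constant coefficients on ℝⁿ. -/

import Mathlib

open MeasureTheory Metric Filter Complex
open scoped Topology RealInnerProductSpace Classical

noncomputable section

/-- ℝⁿ with the euclidean norm. -/
abbrev Euc (n : ℕ) := EuclideanSpace ℝ (Fin n)

/-- Partial derivative in the `i`-th coordinate direction. -/
def pd {n : ℕ} (i : Fin n) (f : Euc n → ℂ) : Euc n → ℂ :=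
  fun ξ => fderiv ℝ f ξ (EuclideanSpace.single i 1)

/-- Iterated partial derivatives along a list of coordinate directions
(a multi-index `β` corresponds to the lists containing `i` exactly `β i` times). -/
def pdIter {n : ℕ} : List (Fin n) → (Euc n → ℂ) → (Euc n → ℂ)
  | [], f => f
  | i :: L, f => pd i (pdIter L f)

/-- A smooth cut-off function vanishing near `0` and equal to `1` outside the unit ball. -/
structure IsCutoff {n : ℕ} (χ : Euc n → ℝ) : Prop where
  smooth : ContDiff ℝ (⊤ : ℕ∞) χ
  zero_near : ∃ ε > (0:ℝ), ∀ ξ : Euc n, ‖ξ‖ < ε → χ ξ = 0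
  one_far : ∀ ξ : Euc n, 1 ≤ ‖ξ‖ → χ ξ = 1

/-- `σ` is a classical symbol of order `a` with constant coefficients on `ℝⁿ`, with
homogeneous components `σc j` of degree `a - j`. -/
structure IsCS {n : ℕ} (χ : Euc n → ℝ) (a : ℂ) (σ : Euc n → ℂ)
    (σc : ℕ → Euc n → ℂ) : Prop where
  smooth : ContDiff ℝ (⊤ : ℕ∞) σ
  comp_smooth : ∀ j, ContDiffOn ℝ (⊤ : ℕ∞) (σc j) {(0 : Euc n)}ᶜ
  comp_homog : ∀ (j : ℕ) (t : ℝ), 0 < t → ∀ ξ : Euc n, ξ ≠ 0 →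
    σc j (t • ξ) = (t : ℂ) ^ (a - j) * σc j ξ
  estimate : ∀ (N : ℕ) (L : List (Fin n)), ∃ C > (0:ℝ), ∀ ξ : Euc n,
    ‖pdIter L (fun η => σ η - ∑ j ∈ Finset.range N, (χ η : ℂ) * σc j η) ξ‖ ≤
      C * (1 + ‖ξ‖) ^ (a.re - N - L.length : ℝ)

/-- A smoothing symbol with constant coefficients on `ℝⁿ`. -/
def IsSmoothing {n : ℕ} (σ : Euc n → ℂ) : Prop :=
  ContDiff ℝ (⊤ : ℕ∞) σ ∧
    ∀ (L : List (Fin n)) (M : ℝ), 0 < M → ∃ C > (0:ℝ), ∀ ξ : Euc n,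
      ‖pdIter L σ ξ‖ ≤ C * (1 + ‖ξ‖) ^ (-M)

/-- The surface measure on the unit sphere `S^{n-1} ⊂ ℝⁿ`. -/
def sphMeas (n : ℕ) : Measure (sphere (0 : Euc n) 1) :=
  (volume : Measure (Euc n)).toSphere

/-- The integral of a homogeneous component over the unit sphere. -/
def sphInt {n : ℕ} (f : Euc n → ℂ) : ℂ :=
  ∫ ω : sphere (0 : Euc n) 1, f ↑ω ∂(sphMeas n)

/-- The noncommutative residue of a classical symbol of order `a` with homogeneous
components `σc j` of degree `a - j`. -/
def resCC {n : ℕ} (a : ℂ) (σc : ℕ → Euc n → ℂ) : ℂ :=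
  if h : ∃ j : ℕ, a - j = -(n : ℂ) then
    (((2 * Real.pi) ^ (-(n : ℝ) / 2) : ℝ) : ℂ) * sphInt (σc h.choose)
  else 0

/-- The cut-off regularised integral of a classical symbol of order `a` with homogeneous
components `σc`, computed with an integer `N` such that `Re a - N < -n`. -/
def cutoffInt {n : ℕ} (χ : Euc n → ℝ) (a : ℂ) (σ : Euc n → ℂ)
    (σc : ℕ → Euc n → ℂ) (N : ℕ) : ℂ :=
  (∫ ξ : Euc n, (σ ξ - ∑ j ∈ Finset.range N, (χ ξ : ℂ) * σc j ξ))
  + ∑ j ∈ Finset.range N, ∫ ξ in Metric.ball (0 : Euc n) 1, (χ ξ : ℂ) * σc j ξ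
  - ∑ j ∈ Finset.range N,
      if a - j + n ≠ 0 then (a - j + n)⁻¹ * sphInt (σc j) else 0


/-- The linear span of all classical symbols with constant coefficients on `ℝⁿ`. -/
def CSspan (n : ℕ) (χ : Euc n → ℝ) : Submodule ℂ (Euc n → ℂ) :=
  Submodule.span ℂ {σ | ∃ a σc, IsCS χ a σ σc}

section PartialDerivatives

variable {n : ℕ}

theorem ContDiffOn.pd {U : Set (Euc n)} (hU : IsOpen U) {f : Euc n → ℂ}
    (hf : ContDiffOn ℝ (⊤ : ℕ∞) f U) (i : Fin n) : ContDiffOn ℝ (⊤ : ℕ∞) (pd i f) U :=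
  (hf.fderiv_of_isOpen hU (by simp)).clm_apply contDiffOn_const

theorem ContDiffOn.pdIter {U : Set (Euc n)} (hU : IsOpen U) {f : Euc n → ℂ}
    (hf : ContDiffOn ℝ (⊤ : ℕ∞) f U) (L : List (Fin n)) :
    ContDiffOn ℝ (⊤ : ℕ∞) (pdIter L f) U := by
  induction L with
  | nil => exact hf
  | cons i L ih => exact ih.pd hU i

theorem ContDiff.pd {f : Euc n → ℂ} (hf : ContDiff ℝ (⊤ : ℕ∞) f) (i : Fin n) :
    ContDiff ℝ (⊤ : ℕ∞) (pd i f) :=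
  contDiffOn_univ.1 ((contDiffOn_univ.2 hf).pd isOpen_univ i)

theorem ContDiff.pdIter {f : Euc n → ℂ} (hf : ContDiff ℝ (⊤ : ℕ∞) f) (L : List (Fin n)) :
    ContDiff ℝ (⊤ : ℕ∞) (pdIter L f) :=
  contDiffOn_univ.1 ((contDiffOn_univ.2 hf).pdIter isOpen_univ L)

theorem ContDiffOn.differentiableAt_of_isOpen {U : Set (Euc n)} (hU : IsOpen U) {f : Euc n → ℂ}
    (hf : ContDiffOn ℝ (⊤ : ℕ∞) f U) {ξ : Euc n} (hξ : ξ ∈ U) : DifferentiableAt ℝ f ξ :=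
  (hf.contDiffAt (hU.mem_nhds hξ)).differentiableAt (by simp)

theorem eqOn_pd {U : Set (Euc n)} (hU : IsOpen U) {f g : Euc n → ℂ} (h : Set.EqOn f g U)
    (i : Fin n) : Set.EqOn (pd i f) (pd i g) U := fun ξ hξ => by
  simp only [pd]
  rw [Filter.EventuallyEq.fderiv_eq (h.eventuallyEq_of_mem (hU.mem_nhds hξ))]

theorem eqOn_pdIter {U : Set (Euc n)} (hU : IsOpen U) {f g : Euc n → ℂ} (h : Set.EqOn f g U)
    (L : List (Fin n)) : Set.EqOn (pdIter L f) (pdIter L g) U := by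
  induction L with
  | nil => exact h
  | cons i L ih => exact eqOn_pd hU ih i

theorem pdIter_concat (L : List (Fin n)) (i : Fin n) (f : Euc n → ℂ) :
    pdIter (L ++ [i]) f = pdIter L (pd i f) := by
  induction L with
  | nil => rfl
  | cons j L ih => simp [pdIter, ih]

theorem pdIter_add {U : Set (Euc n)} (hU : IsOpen U) {f g : Euc n → ℂ}
    (hf : ContDiffOn ℝ (⊤ : ℕ∞) f U) (hg : ContDiffOn ℝ (⊤ : ℕ∞) g U) (L : List (Fin n)) :
    Set.EqOn (pdIter L (fun ξ => f ξ + g ξ)) (fun ξ => pdIter L f ξ + pdIter L g ξ) U := by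
  induction L with
  | nil => exact fun _ _ => rfl
  | cons i L ih =>
    refine (eqOn_pd hU ih i).trans fun ξ hξ => ?_
    simp only [pd, pdIter]
    rw [fderiv_fun_add ((hf.pdIter hU L).differentiableAt_of_isOpen hU hξ)
      ((hg.pdIter hU L).differentiableAt_of_isOpen hU hξ)]
    rfl

theorem pd_const_mul {U : Set (Euc n)} (hU : IsOpen U) {f : Euc n → ℂ}
    (hf : ContDiffOn ℝ (⊤ : ℕ∞) f U) (c : ℂ) (i : Fin n) :
    Set.EqOn (pd i (fun ξ => c * f ξ)) (fun ξ => c * pd i f ξ) U := fun ξ hξ => by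
  simp only [pd]
  rw [fderiv_const_mul (hf.differentiableAt_of_isOpen hU hξ)]
  rfl

theorem pdIter_const_mul {U : Set (Euc n)} (hU : IsOpen U) {f : Euc n → ℂ}
    (hf : ContDiffOn ℝ (⊤ : ℕ∞) f U) (c : ℂ) (L : List (Fin n)) :
    Set.EqOn (pdIter L (fun ξ => c * f ξ)) (fun ξ => c * pdIter L f ξ) U := by
  induction L with
  | nil => exact fun _ _ => rfl
  | cons i L ih => exact (eqOn_pd hU ih i).trans (pd_const_mul hU (hf.pdIter hU L) c i)

theorem pd_mul {U : Set (Euc n)} (hU : IsOpen U) {f g : Euc n → ℂ}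
    (hf : ContDiffOn ℝ (⊤ : ℕ∞) f U) (hg : ContDiffOn ℝ (⊤ : ℕ∞) g U) (i : Fin n) :
    Set.EqOn (pd i (fun ξ => f ξ * g ξ)) (fun ξ => pd i f ξ * g ξ + f ξ * pd i g ξ) U :=
  fun ξ hξ => by
  simp only [pd]
  rw [fderiv_fun_mul (hf.differentiableAt_of_isOpen hU hξ) (hg.differentiableAt_of_isOpen hU hξ)]
  simp only [_root_.add_apply, _root_.smul_apply, smul_eq_mul]
  ring

theorem pd_sum {ι : Type*} (s : Finset ι) {U : Set (Euc n)} (hU : IsOpen U) {f : ι → Euc n → ℂ}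
    (hf : ∀ j ∈ s, ContDiffOn ℝ (⊤ : ℕ∞) (f j) U) (i : Fin n) :
    Set.EqOn (pd i (fun ξ => ∑ j ∈ s, f j ξ)) (fun ξ => ∑ j ∈ s, pd i (f j) ξ) U :=
  fun ξ hξ => by
  simp only [pd]
  rw [fderiv_fun_sum fun j hj => (hf j hj).differentiableAt_of_isOpen hU hξ]
  simp

/-- The `i`-th coordinate as a complex-valued function. -/
def coordFun (i : Fin n) : Euc n → ℂ := fun ξ => (ξ i : ℂ)

theorem contDiff_coordFun (i : Fin n) : ContDiff ℝ (⊤ : ℕ∞) (coordFun i) := by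
  unfold coordFun
  exact Complex.ofRealCLM.contDiff.comp (EuclideanSpace.proj i : Euc n →L[ℝ] ℝ).contDiff

theorem pd_coordFun (i : Fin n) (ξ : Euc n) : pd i (coordFun i) ξ = 1 := by
  have h : HasFDerivAt (coordFun i : Euc n → ℂ)
      (Complex.ofRealCLM ∘L (EuclideanSpace.proj i : Euc n →L[ℝ] ℝ)) ξ :=
    (Complex.ofRealCLM ∘L (EuclideanSpace.proj i : Euc n →L[ℝ] ℝ)).hasFDerivAt
  simp [pd, h.fderiv]

theorem clm_apply_eq_sum {G : Type*} [NormedAddCommGroup G] [NormedSpace ℝ G]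
    (T : Euc n →L[ℝ] G) (v : Euc n) :
    T v = ∑ i, v i • T (EuclideanSpace.single i 1) := by
  conv_lhs => rw [← (EuclideanSpace.basisFun (Fin n) ℝ).sum_repr v]
  simp [map_sum]

theorem fderiv_apply_eq_sum (f : Euc n → ℂ) (ξ v : Euc n) :
    fderiv ℝ f ξ v = ∑ i, coordFun i v * pd i f ξ := by
  rw [clm_apply_eq_sum]
  simp [pd, coordFun]

theorem fderiv_eq_sum (f : Euc n → ℂ) (ξ : Euc n) :
    fderiv ℝ f ξ = ∑ i, (EuclideanSpace.proj i : Euc n →L[ℝ] ℝ).smulRight (pd i f ξ) := by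
  ext v
  rw [fderiv_apply_eq_sum]
  simp [coordFun]

/-- A function is smooth on an open set if it belongs to a family of functions differentiable
there that is stable, up to equality on that set, under partial differentiation. -/
theorem contDiffOn_of_family {U : Set (Euc n)} (hU : IsOpen U) (F : (Euc n → ℂ) → Prop)
    (hdiff : ∀ f, F f → DifferentiableOn ℝ f U)
    (hpd : ∀ f, F f → ∀ i, ∃ g, F g ∧ Set.EqOn (pd i f) g U) {f : Euc n → ℂ} (hf : F f) :
    ContDiffOn ℝ (⊤ : ℕ∞) f U := by
  have key : ∀ N : ℕ, ∀ f, F f → ContDiffOn ℝ N f U := by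
    intro N
    induction N with
    | zero => exact fun f hf => by simpa using (hdiff f hf).continuousOn
    | succ N ih =>
      intro f hf
      push_cast
      rw [contDiffOn_succ_iff_fderiv_of_isOpen hU]
      refine ⟨hdiff f hf, by simp, ?_⟩
      have : (fun ξ => fderiv ℝ f ξ) = fun ξ =>
          ∑ i, (EuclideanSpace.proj i : Euc n →L[ℝ] ℝ).smulRight (pd i f ξ) :=
        funext fun ξ => fderiv_eq_sum f ξ
      change ContDiffOn ℝ N (fun ξ => fderiv ℝ f ξ) U
      rw [this]
      refine ContDiffOn.sum fun i _ => contDiffOn_const.smulRight ?_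
      obtain ⟨g, hg, hfg⟩ := hpd f hf i
      exact (ih g hg).congr hfg
  exact contDiffOn_infty.2 fun N => key N f hf

end PartialDerivatives

section ParametricIntegrals

variable {n : ℕ} {α : Type*} [MeasurableSpace α]

/-- A family of parametrised functions which is stable under partial differentiation and locally
dominated, so that integration with respect to the parameter yields smooth functions and commutes
with partial derivatives. -/
structure IsDominatedFamily (μ : Measure α) (U : Set (Euc n)) (F : (α → Euc n → ℂ) → Prop) :
    Prop where
  meas : ∀ Φ, F Φ → ∀ ξ ∈ U, AEStronglyMeasurable (fun p => Φ p ξ) μ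
  diff : ∀ Φ, F Φ → ∀ᵐ p ∂μ, DifferentiableOn ℝ (Φ p) U
  pd_mem : ∀ Φ, F Φ → ∀ i, ∃ Ψ, F Ψ ∧ ∀ᵐ p ∂μ, Set.EqOn (pd i (Φ p)) (Ψ p) U
  dom : ∀ Φ, F Φ → ∀ ξ ∈ U, ∃ V ∈ 𝓝 ξ, ∃ b : α → ℝ, Integrable b μ ∧
    ∀ᵐ p ∂μ, ∀ η ∈ V, ‖Φ p η‖ ≤ b p

namespace IsDominatedFamily

variable {μ : Measure α} {U : Set (Euc n)} {F : (α → Euc n → ℂ) → Prop}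

theorem integrable (hF : IsDominatedFamily μ U F) {Φ : α → Euc n → ℂ} (hΦ : F Φ) {ξ : Euc n}
    (hξ : ξ ∈ U) : Integrable (fun p => Φ p ξ) μ := by
  obtain ⟨V, hV, b, hb, hle⟩ := hF.dom Φ hΦ ξ hξ
  exact hb.mono' (hF.meas Φ hΦ ξ hξ) (hle.mono fun p hp => hp ξ (mem_of_mem_nhds hV))

theorem hasFDerivAt (hF : IsDominatedFamily μ U F) (hU : IsOpen U) {Φ : α → Euc n → ℂ}
    (hΦ : F Φ) {Ψ : Fin n → α → Euc n → ℂ} (hΨ : ∀ i, F (Ψ i))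
    (h : ∀ i, ∀ᵐ p ∂μ, Set.EqOn (pd i (Φ p)) (Ψ i p) U) {ξ : Euc n} (hξ : ξ ∈ U) :
    HasFDerivAt (fun η => ∫ p, Φ p η ∂μ)
      (∑ i, (EuclideanSpace.proj i : Euc n →L[ℝ] ℝ).smulRight (∫ p, Ψ i p ξ ∂μ)) ξ := by
  choose V hV b hb hle using fun i => hF.dom (Ψ i) (hΨ i) ξ hξ
  have hint : ∫ p, (∑ i, (EuclideanSpace.proj i : Euc n →L[ℝ] ℝ).smulRight (Ψ i p ξ)) ∂μ =
      ∑ i, (EuclideanSpace.proj i : Euc n →L[ℝ] ℝ).smulRight (∫ p, Ψ i p ξ ∂μ) := by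
    have hi : ∀ i, Integrable (fun p =>
        (EuclideanSpace.proj i : Euc n →L[ℝ] ℝ).smulRight (Ψ i p ξ)) μ := fun i =>
      (ContinuousLinearMap.smulRightL ℝ (Euc n) ℂ (EuclideanSpace.proj i)).integrable_comp
        (hF.integrable (hΨ i) hξ)
    rw [integral_finsetSum _ fun i _ => hi i]
    refine Finset.sum_congr rfl fun i _ => ?_
    exact (ContinuousLinearMap.smulRightL ℝ (Euc n) ℂ
      (EuclideanSpace.proj i)).integral_comp_comm (hF.integrable (hΨ i) hξ)
  rw [← hint]
  have hW : U ∩ ⋂ i, V i ∈ 𝓝 ξ :=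
    inter_mem (hU.mem_nhds hξ) (iInter_mem.2 hV)
  refine hasFDerivAt_integral_of_dominated_of_fderiv_le (bound := fun p => ∑ i, b i p)
    (F' := fun η p => ∑ i, (EuclideanSpace.proj i : Euc n →L[ℝ] ℝ).smulRight (Ψ i p η))
    hW ?_ (hF.integrable hΦ hξ) ?_ ?_ (integrable_finsetSum _ fun i _ => hb i) ?_
  · exact (hU.eventually_mem hξ).mono fun η hη => hF.meas Φ hΦ η hη
  · refine Finset.aestronglyMeasurable_fun_sum _ fun i _ => ?_
    exact (ContinuousLinearMap.smulRightL ℝ (Euc n) ℂ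
      (EuclideanSpace.proj i)).continuous.comp_aestronglyMeasurable (hF.meas _ (hΨ i) ξ hξ)
  · filter_upwards [ae_all_iff.2 hle] with p hp η hη
    refine (norm_sum_le _ _).trans (Finset.sum_le_sum fun i _ => ?_)
    rw [ContinuousLinearMap.norm_smulRight_apply]
    have h1 : ‖(EuclideanSpace.proj i : Euc n →L[ℝ] ℝ)‖ ≤ 1 :=
      ContinuousLinearMap.opNorm_le_bound _ zero_le_one fun v => by
        simpa using PiLp.norm_apply_le v i
    calc _ ≤ 1 * ‖Ψ i p η‖ := by gcongr
      _ ≤ b i p := by rw [one_mul]; exact hp i η (Set.mem_iInter.1 hη.2 i)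
  · filter_upwards [ae_all_iff.2 h, hF.diff Φ hΦ] with p hp hd η hη
    have := ((hd η hη.1).differentiableAt (hU.mem_nhds hη.1)).hasFDerivAt
    rw [fderiv_eq_sum] at this
    simp only [fun i => (hp i hη.1).symm]
    exact this

theorem pd_integral (hF : IsDominatedFamily μ U F) (hU : IsOpen U) {Φ Ψ : α → Euc n → ℂ}
    (hΦ : F Φ) {i : Fin n} (h : ∀ᵐ p ∂μ, Set.EqOn (pd i (Φ p)) (Ψ p) U) :
    Set.EqOn (pd i (fun η => ∫ p, Φ p η ∂μ)) (fun η => ∫ p, Ψ p η ∂μ) U := fun ξ hξ => by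
  choose Ψ' hΨ' h' using hF.pd_mem Φ hΦ
  have := hF.hasFDerivAt hU hΦ hΨ' h' hξ
  rw [pd, this.fderiv]
  rw [sum_apply, Finset.sum_eq_single i]
  · have h1 : (EuclideanSpace.proj i : Euc n →L[ℝ] ℝ) (EuclideanSpace.single i 1) = 1 := by simp
    rw [ContinuousLinearMap.smulRight_apply, h1, one_smul]
    refine integral_congr_ae ?_
    filter_upwards [h, h' i] with p hp hp'
    exact (hp' hξ).symm.trans (hp hξ)
  · intro j _ hj
    simp [hj]
  · simp

theorem contDiffOn (hF : IsDominatedFamily μ U F) (hU : IsOpen U) {Φ : α → Euc n → ℂ}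
    (hΦ : F Φ) : ContDiffOn ℝ (⊤ : ℕ∞) (fun η => ∫ p, Φ p η ∂μ) U := by
  refine contDiffOn_of_family hU (fun f => ∃ Φ, F Φ ∧ f = fun η => ∫ p, Φ p η ∂μ) ?_ ?_
    ⟨Φ, hΦ, rfl⟩
  · rintro _ ⟨Φ, hΦ, rfl⟩ ξ hξ
    choose Ψ hΨ h using hF.pd_mem Φ hΦ
    exact (hF.hasFDerivAt hU hΦ hΨ h hξ).differentiableAt.differentiableWithinAt
  · rintro _ ⟨Φ, hΦ, rfl⟩ i
    obtain ⟨Ψ, hΨ, h⟩ := hF.pd_mem Φ hΦ i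
    exact ⟨_, ⟨Ψ, hΨ, rfl⟩, hF.pd_integral hU hΦ h⟩

end IsDominatedFamily

end ParametricIntegrals

section Symbols

variable {n : ℕ}

theorem isOpen_norm_gt (r : ℝ) : IsOpen {ξ : Euc n | r < ‖ξ‖} :=
  isOpen_lt continuous_const continuous_norm

theorem norm_gt_subset {r : ℝ} (hr : 0 ≤ r) : {ξ : Euc n | r < ‖ξ‖} ⊆ {0}ᶜ := fun _ hξ =>
  norm_pos_iff.1 (hr.trans_lt hξ)

theorem pd_comp_smul (f : Euc n → ℂ) (c : ℝ) (i : Fin n) (ξ : Euc n) :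
    pd i (fun η => f (c • η)) ξ = (c : ℂ) * pd i f (c • ξ) := by
  simp only [pd]
  have := fderiv_comp_smul (𝕜 := ℝ) (f := f) (x := ξ) c
  rw [this]
  simp

/-- Positive homogeneity of complex degree `d` on `ℝⁿ∖{0}`. -/
def IsHomog (d : ℂ) (f : Euc n → ℂ) : Prop :=
  ∀ t : ℝ, 0 < t → ∀ ξ : Euc n, ξ ≠ 0 → f (t • ξ) = (t : ℂ) ^ d * f ξ

theorem IsHomog.map_pd {d : ℂ} {f : Euc n → ℂ} (hf : IsHomog d f)
    (hs : ContDiffOn ℝ (⊤ : ℕ∞) f {0}ᶜ) (i : Fin n) : IsHomog (d - 1) (pd i f) := by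
  intro t ht ξ hξ
  have h1 := eqOn_pd isOpen_compl_singleton (f := fun η => f (t • η))
    (g := fun η => (t : ℂ) ^ d * f η) (U := {(0 : Euc n)}ᶜ) (fun η hη => hf t ht η hη) i hξ
  rw [pd_comp_smul, pd_const_mul isOpen_compl_singleton hs _ i hξ] at h1
  have ht' : (t : ℂ) ≠ 0 := by exact_mod_cast ht.ne'
  rw [Complex.cpow_sub _ _ ht', Complex.cpow_one]
  field_simp
  rw [mul_comm]
  exact h1

theorem IsHomog.map_pdIter {d : ℂ} {f : Euc n → ℂ} (hf : IsHomog d f)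
    (hs : ContDiffOn ℝ (⊤ : ℕ∞) f {0}ᶜ) (L : List (Fin n)) :
    IsHomog (d - L.length) (pdIter L f) := by
  induction L with
  | nil => simpa [pdIter] using hf
  | cons i L ih =>
    have := ih.map_pd (hs.pdIter isOpen_compl_singleton L) i
    rw [sub_sub] at this
    simpa [pdIter] using this

theorem IsHomog.mul {d e : ℂ} {f g : Euc n → ℂ} (hf : IsHomog d f) (hg : IsHomog e g) :
    IsHomog (d + e) (fun ξ => f ξ * g ξ) := by
  intro t ht ξ hξ
  have ht' : (t : ℂ) ≠ 0 := by exact_mod_cast ht.ne'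
  simp only [hf t ht ξ hξ, hg t ht ξ hξ, Complex.cpow_add _ _ ht']
  ring

theorem isHomog_coordFun (i : Fin n) : IsHomog 1 (coordFun i) := fun t _ ξ _ => by
  simp [coordFun]

theorem IsHomog.const_mul {d : ℂ} {f : Euc n → ℂ} (hf : IsHomog d f) (c : ℂ) :
    IsHomog d (fun ξ => c * f ξ) := fun t ht ξ hξ => by
  simp only [hf t ht ξ hξ]
  ring

theorem isHomog_zero (d : ℂ) : IsHomog d (fun _ : Euc n => (0 : ℂ)) := fun t _ ξ _ => by simp

/-- Euler's identity for positively homogeneous functions. -/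
theorem IsHomog.euler {d : ℂ} {f : Euc n → ℂ} (hf : IsHomog d f)
    (hs : ContDiffOn ℝ (⊤ : ℕ∞) f {0}ᶜ) {ξ : Euc n} (hξ : ξ ≠ 0) :
    ∑ i, coordFun i ξ * pd i f ξ = d * f ξ := by
  rw [← fderiv_apply_eq_sum]
  have hd : HasFDerivAt f (fderiv ℝ f ξ) ((1 : ℝ) • ξ) := by
    rw [one_smul]
    exact (hs.differentiableAt_of_isOpen isOpen_compl_singleton hξ).hasFDerivAt
  have h1 : HasDerivAt (fun t : ℝ => f (t • ξ)) (fderiv ℝ f ξ ξ) 1 := by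
    have := hd.comp_hasDerivAt (1 : ℝ) ((hasDerivAt_id' (1 : ℝ)).smul_const ξ)
    rw [one_smul] at this
    exact this
  have h2 : HasDerivAt (fun t : ℝ => (t : ℂ) ^ d * f ξ) (d * f ξ) 1 := by
    have := ((hasDerivAt_id' (1 : ℂ)).cpow_const (c := d) (by simp)).mul_const (f ξ)
    simpa using HasDerivAt.comp_ofReal (z := 1) (by simpa using this)
  refine h1.unique (h2.congr_of_eventuallyEq ?_)
  filter_upwards [lt_mem_nhds (zero_lt_one' ℝ)] with t ht
  exact hf t ht ξ hξ

/-- Functions smooth away from the origin which, away from any neighbourhood of the origin, satisfy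
the symbol estimates of order `m`. -/
structure SymbolAway (m : ℝ) (f : Euc n → ℂ) : Prop where
  smooth : ContDiffOn ℝ (⊤ : ℕ∞) f {0}ᶜ
  bound : ∀ r > 0, ∀ L : List (Fin n), ∃ C, ∀ ξ : Euc n, r < ‖ξ‖ →
    ‖pdIter L f ξ‖ ≤ C * ‖ξ‖ ^ (m - L.length)

namespace SymbolAway

variable {m m' : ℝ} {f g : Euc n → ℂ}

theorem congr (hf : SymbolAway m f) (h : ∀ ξ, ξ ≠ 0 → g ξ = f ξ) : SymbolAway m g where
  smooth := hf.smooth.congr h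
  bound r hr L := by
    obtain ⟨C, hC⟩ := hf.bound r hr L
    refine ⟨C, fun ξ hξ => ?_⟩
    rw [eqOn_pdIter isOpen_compl_singleton (fun ξ hξ => h ξ hξ) L (norm_gt_subset hr.le hξ)]
    exact hC ξ hξ

theorem map_pd (hf : SymbolAway m f) (i : Fin n) : SymbolAway (m - 1) (pd i f) where
  smooth := hf.smooth.pd isOpen_compl_singleton i
  bound r hr L := by
    obtain ⟨C, hC⟩ := hf.bound r hr (L ++ [i])
    refine ⟨C, fun ξ hξ => ?_⟩
    rw [← pdIter_concat]
    convert hC ξ hξ using 3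
    simp
    ring

theorem add (hf : SymbolAway m f) (hg : SymbolAway m g) : SymbolAway m (fun ξ => f ξ + g ξ) where
  smooth := hf.smooth.add hg.smooth
  bound r hr L := by
    obtain ⟨C, hC⟩ := hf.bound r hr L
    obtain ⟨D, hD⟩ := hg.bound r hr L
    refine ⟨C + D, fun ξ hξ => ?_⟩
    rw [pdIter_add isOpen_compl_singleton hf.smooth hg.smooth L (norm_gt_subset hr.le hξ), add_mul]
    exact (norm_add_le _ _).trans (add_le_add (hC ξ hξ) (hD ξ hξ))

theorem const_mul (hf : SymbolAway m f) (c : ℂ) : SymbolAway m (fun ξ => c * f ξ) where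
  smooth := contDiffOn_const.mul hf.smooth
  bound r hr L := by
    obtain ⟨C, hC⟩ := hf.bound r hr L
    refine ⟨‖c‖ * C, fun ξ hξ => ?_⟩
    rw [pdIter_const_mul isOpen_compl_singleton hf.smooth c L (norm_gt_subset hr.le hξ), norm_mul,
      mul_assoc]
    gcongr
    exact hC ξ hξ

theorem mul (hf : SymbolAway m f) (hg : SymbolAway m' g) :
    SymbolAway (m + m') (fun ξ => f ξ * g ξ) where
  smooth := hf.smooth.mul hg.smooth
  bound r hr L := by
    induction L using List.reverseRecOn generalizing m m' f g with
    | nil =>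
      obtain ⟨C, hC⟩ := hf.bound r hr []
      obtain ⟨D, hD⟩ := hg.bound r hr []
      refine ⟨C * D, fun ξ hξ => ?_⟩
      have h1 := hC ξ hξ
      have h2 := hD ξ hξ
      simp only [pdIter, List.length_nil, Nat.cast_zero, sub_zero] at h1 h2 ⊢
      rw [norm_mul, Real.rpow_add (hr.trans hξ), mul_mul_mul_comm]
      exact mul_le_mul h1 h2 (norm_nonneg _) ((norm_nonneg _).trans h1)
    | append_singleton L i ih =>
      obtain ⟨C, hC⟩ := ih (hf.map_pd i) hg
      obtain ⟨D, hD⟩ := ih hf (hg.map_pd i)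
      refine ⟨C + D, fun ξ hξ => ?_⟩
      have hξ' := norm_gt_subset hr.le hξ
      rw [pdIter_concat, eqOn_pdIter isOpen_compl_singleton
        (pd_mul isOpen_compl_singleton hf.smooth hg.smooth i) L hξ',
        pdIter_add isOpen_compl_singleton ((hf.map_pd i).smooth.mul hg.smooth)
          (hf.smooth.mul (hg.map_pd i).smooth) L hξ', add_mul]
      have h1 := hC ξ hξ
      have h2 := hD ξ hξ
      have e1 : m - 1 + m' - L.length = m + m' - (L ++ [i]).length := by simp; ring
      have e2 : m + (m' - 1) - L.length = m + m' - (L ++ [i]).length := by simp; ring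
      rw [e1] at h1
      rw [e2] at h2
      exact (norm_add_le _ _).trans (add_le_add h1 h2)

theorem of_isHomog {d : ℂ} (hf : IsHomog d f) (hs : ContDiffOn ℝ (⊤ : ℕ∞) f {0}ᶜ) :
    SymbolAway d.re f where
  smooth := hs
  bound r hr L := by
    obtain ⟨C, hC⟩ := (isCompact_sphere (0 : Euc n) 1).exists_bound_of_continuousOn
      ((hs.pdIter isOpen_compl_singleton L).continuousOn.mono fun ξ hξ => by
        rintro rfl
        simp at hξ)
    refine ⟨C, fun ξ hξ => ?_⟩
    have hpos : 0 < ‖ξ‖ := hr.trans hξ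
    have h0 : ‖ξ‖⁻¹ • ξ ≠ 0 := smul_ne_zero (inv_ne_zero hpos.ne') (norm_pos_iff.1 hpos)
    have h1 := hf.map_pdIter hs L ‖ξ‖ hpos (‖ξ‖⁻¹ • ξ) h0
    rw [smul_inv_smul₀ hpos.ne'] at h1
    rw [h1, norm_mul, Complex.norm_cpow_eq_rpow_re_of_pos hpos, mul_comm]
    simp only [sub_re, natCast_re]
    gcongr
    exact hC _ (by simp [norm_smul, hpos.ne'])

theorem of_eqOn (hg : SymbolAway m g) (hs : ContDiffOn ℝ (⊤ : ℕ∞) f {0}ᶜ)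
    (h : Set.EqOn f g {ξ | 1 < ‖ξ‖}) : SymbolAway m f where
  smooth := hs
  bound r hr L := by
    obtain ⟨C, hC⟩ := hg.bound 1 one_pos L
    have hK : IsCompact (closedBall (0 : Euc n) 1 \ ball 0 r) :=
      (isCompact_closedBall _ _).diff isOpen_ball
    have hc : ContinuousOn (fun ξ : Euc n => ‖ξ‖ ^ (-(m - L.length)) • pdIter L f ξ)
        (closedBall (0 : Euc n) 1 \ ball 0 r) := by
      have h0 : ∀ ξ ∈ closedBall (0 : Euc n) 1 \ ball 0 r, ξ ≠ 0 := by
        rintro _ hξ rfl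
        exact hξ.2 (by simpa using hr)
      have hpow : ContinuousOn (fun ξ : Euc n => ‖ξ‖ ^ (-(m - L.length)))
          (closedBall (0 : Euc n) 1 \ ball 0 r) :=
        continuous_norm.continuousOn.rpow_const fun ξ hξ => Or.inl (norm_ne_zero_iff.2 (h0 ξ hξ))
      exact hpow.smul ((hs.pdIter isOpen_compl_singleton L).continuousOn.mono h0)
    obtain ⟨D, hD⟩ := hK.exists_bound_of_continuousOn hc
    refine ⟨max C D, fun ξ hξ => ?_⟩
    have hpos : 0 < ‖ξ‖ := hr.trans hξ
    rcases lt_or_ge 1 ‖ξ‖ with h1 | h1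
    · rw [eqOn_pdIter (isOpen_norm_gt 1) h L h1]
      refine (hC ξ h1).trans ?_
      gcongr
      exact le_max_left _ _
    · have := hD ξ ⟨by simpa using h1, by simpa using hξ.le⟩
      rw [norm_smul, Real.norm_of_nonneg (by positivity), Real.rpow_neg hpos.le,
        inv_mul_le_iff₀ (by positivity), mul_comm] at this
      refine this.trans ?_
      gcongr
      exact le_max_right _ _

theorem of_eq_zero (hs : ContDiffOn ℝ (⊤ : ℕ∞) f {0}ᶜ) (h : ∀ ξ, 1 < ‖ξ‖ → f ξ = 0) :
    SymbolAway m f := by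
  have h0 : SymbolAway m (fun _ : Euc n => (0 : ℂ)) := by
    have := SymbolAway.of_isHomog (isHomog_zero (n := n) (m : ℂ)) contDiffOn_const
    simpa using this
  exact h0.of_eqOn hs fun ξ hξ => h ξ hξ

theorem estimate (hf : SymbolAway m f) (hs : ContDiff ℝ (⊤ : ℕ∞) f) (L : List (Fin n)) :
    ∃ C > (0 : ℝ), ∀ ξ : Euc n, ‖pdIter L f ξ‖ ≤ C * (1 + ‖ξ‖) ^ (m - L.length) := by
  obtain ⟨C, hC⟩ := hf.bound 1 one_pos L
  set e := m - L.length with he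
  have hc : Continuous (fun ξ : Euc n => (1 + ‖ξ‖) ^ (-e) • pdIter L f ξ) := by
    have hpow : Continuous (fun ξ : Euc n => (1 + ‖ξ‖) ^ (-e)) :=
      (by fun_prop : Continuous fun ξ : Euc n => 1 + ‖ξ‖).rpow_const fun ξ =>
        Or.inl (by positivity)
    exact hpow.smul (hs.pdIter L).continuous
  obtain ⟨D, hD⟩ := (isCompact_closedBall (0 : Euc n) 1).exists_bound_of_continuousOn
    hc.continuousOn
  refine ⟨|C| * 2 ^ |e| + |D| + 1, by positivity, fun ξ => ?_⟩
  have hp : 0 < 1 + ‖ξ‖ := by positivity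
  rcases lt_or_ge 1 ‖ξ‖ with h1 | h1
  · have hpos : 0 < ‖ξ‖ := one_pos.trans h1
    have key : ‖ξ‖ ^ e ≤ 2 ^ |e| * (1 + ‖ξ‖) ^ e := by
      rcases le_or_gt 0 e with h | h
      · calc ‖ξ‖ ^ e ≤ (1 + ‖ξ‖) ^ e := Real.rpow_le_rpow hpos.le (by linarith) h
          _ ≤ _ := le_mul_of_one_le_left (by positivity)
            (Real.one_le_rpow one_le_two (abs_nonneg e))
      · rw [abs_of_neg h, Real.rpow_neg zero_le_two, ← Real.inv_rpow zero_le_two,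
          ← Real.mul_rpow (by norm_num) hp.le]
        exact Real.rpow_le_rpow_of_nonpos (by positivity) (by linarith) h.le
    calc ‖pdIter L f ξ‖ ≤ C * ‖ξ‖ ^ e := hC ξ h1
      _ ≤ |C| * (2 ^ |e| * (1 + ‖ξ‖) ^ e) := by
        gcongr
        exact le_abs_self C
      _ = |C| * 2 ^ |e| * (1 + ‖ξ‖) ^ e := by ring
      _ ≤ _ := by
        gcongr
        linarith [abs_nonneg D]
  · have := hD ξ (by simpa using h1)
    rw [norm_smul, Real.norm_of_nonneg (by positivity), Real.rpow_neg hp.le,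
      inv_mul_le_iff₀ (by positivity), mul_comm] at this
    refine this.trans ?_
    gcongr
    have : 0 ≤ |C| * 2 ^ |e| := by positivity
    linarith [le_abs_self D]

theorem of_estimate (hs : ContDiff ℝ (⊤ : ℕ∞) f)
    (h : ∀ L : List (Fin n), ∃ C > (0 : ℝ), ∀ ξ : Euc n,
      ‖pdIter L f ξ‖ ≤ C * (1 + ‖ξ‖) ^ (m - L.length)) : SymbolAway m f where
  smooth := hs.contDiffOn
  bound r hr L := by
    obtain ⟨C, hC0, hC⟩ := h L
    set e := m - L.length with he
    refine ⟨C * (1 + r⁻¹) ^ |e|, fun ξ hξ => (hC ξ).trans ?_⟩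
    have hpos : 0 < ‖ξ‖ := hr.trans hξ
    rw [mul_assoc]
    gcongr
    rcases le_or_gt 0 e with h | h
    · rw [abs_of_nonneg h, ← Real.mul_rpow (by positivity) hpos.le]
      refine Real.rpow_le_rpow (by positivity) ?_ h
      have : 1 ≤ r⁻¹ * ‖ξ‖ := by
        rw [← div_eq_inv_mul, one_le_div hr]
        exact hξ.le
      linarith
    · calc (1 + ‖ξ‖) ^ e ≤ ‖ξ‖ ^ e := Real.rpow_le_rpow_of_nonpos hpos (by linarith) h.le
        _ ≤ _ := le_mul_of_one_le_left (by positivity)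
            (Real.one_le_rpow (by simp [hr.le]) (abs_nonneg e))

end SymbolAway

end Symbols

section ClassicalSymbols

variable {n : ℕ} {χ : Euc n → ℝ} {a : ℂ} {σ : Euc n → ℂ} {σc : ℕ → Euc n → ℂ}

theorem IsCutoff.contDiff_mul (hχ : IsCutoff χ) {g : Euc n → ℂ}
    (hg : ContDiffOn ℝ (⊤ : ℕ∞) g {0}ᶜ) : ContDiff ℝ (⊤ : ℕ∞) (fun ξ => (χ ξ : ℂ) * g ξ) := by
  rw [contDiff_iff_contDiffAt]
  intro ξ
  by_cases hξ : ξ = 0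
  · obtain ⟨ε, hε, h0⟩ := hχ.zero_near
    refine (contDiffAt_const (c := (0 : ℂ))).congr_of_eventuallyEq ?_
    filter_upwards [ball_mem_nhds ξ hε] with η hη
    simp [h0 η (by simpa [hξ] using hη)]
  · exact (Complex.ofRealCLM.contDiff.comp hχ.smooth).contDiffAt.mul
      (hg.contDiffAt (isOpen_compl_singleton.mem_nhds hξ))

theorem IsCutoff.mul_eqOn (hχ : IsCutoff χ) (g : Euc n → ℂ) :
    Set.EqOn (fun ξ => (χ ξ : ℂ) * g ξ) g {ξ | 1 < ‖ξ‖} := fun ξ hξ => by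
  simp [hχ.one_far ξ (le_of_lt hξ)]

theorem IsCutoff.contDiff_sub_sum (hχ : IsCutoff χ) (hσ : ContDiff ℝ (⊤ : ℕ∞) σ)
    (hc : ∀ j, ContDiffOn ℝ (⊤ : ℕ∞) (σc j) {0}ᶜ) (N : ℕ) :
    ContDiff ℝ (⊤ : ℕ∞) (fun η => σ η - ∑ j ∈ Finset.range N, (χ η : ℂ) * σc j η) :=
  hσ.sub (ContDiff.sum fun j _ => hχ.contDiff_mul (hc j))

theorem IsCutoff.sub_sum_eqOn (hχ : IsCutoff χ) (σ : Euc n → ℂ) (σc : ℕ → Euc n → ℂ) (N : ℕ) :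
    Set.EqOn (fun η => σ η - ∑ j ∈ Finset.range N, (χ η : ℂ) * σc j η)
      (fun η => σ η - ∑ j ∈ Finset.range N, σc j η) {ξ | 1 < ‖ξ‖} := fun ξ hξ => by
  simp [hχ.one_far ξ (le_of_lt hξ)]

theorem isCS_of_symbolAway (hχ : IsCutoff χ) (hσ : ContDiff ℝ (⊤ : ℕ∞) σ)
    (hc : ∀ j, ContDiffOn ℝ (⊤ : ℕ∞) (σc j) {0}ᶜ) (hh : ∀ j : ℕ, IsHomog (a - j) (σc j))
    (h : ∀ N : ℕ, SymbolAway (a.re - N) (fun ξ => σ ξ - ∑ j ∈ Finset.range N, σc j ξ)) :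
    IsCS χ a σ σc where
  smooth := hσ
  comp_smooth := hc
  comp_homog := hh
  estimate N L := ((h N).of_eqOn (hχ.contDiff_sub_sum hσ hc N).contDiffOn
    (hχ.sub_sum_eqOn σ σc N)).estimate (hχ.contDiff_sub_sum hσ hc N) L

theorem IsCS.symbolAway (hχ : IsCutoff χ) (h : IsCS χ a σ σc) (N : ℕ) :
    SymbolAway (a.re - N) (fun ξ => σ ξ - ∑ j ∈ Finset.range N, σc j ξ) :=
  (SymbolAway.of_estimate (hχ.contDiff_sub_sum h.smooth h.comp_smooth N) (h.estimate N)).of_eqOn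
    (h.smooth.contDiffOn.sub (ContDiffOn.sum fun j _ => h.comp_smooth j))
    (hχ.sub_sum_eqOn σ σc N).symm

theorem IsCS.map_pd (hχ : IsCutoff χ) (h : IsCS χ a σ σc) (i : Fin n) :
    IsCS χ (a - 1) (pd i σ) (fun j => pd i (σc j)) := by
  refine isCS_of_symbolAway hχ (h.smooth.pd i)
    (fun j => (h.comp_smooth j).pd isOpen_compl_singleton i) (fun j => ?_) fun N => ?_
  · have := IsHomog.map_pd (h.comp_homog j) (h.comp_smooth j) i
    rwa [sub_right_comm] at this
  · have := (h.symbolAway hχ N).map_pd i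
    rw [sub_right_comm] at this
    refine (show (a - 1).re = a.re - 1 by simp) ▸ this.congr fun ξ hξ => ?_
    have h1 : pd i (fun ξ => σ ξ + (-1) * ∑ j ∈ Finset.range N, σc j ξ) ξ =
        pd i σ ξ + (-1) * ∑ j ∈ Finset.range N, pd i (σc j) ξ := by
      have hs := ContDiffOn.sum (s := Finset.range N) fun j _ => h.comp_smooth j
      have e1 := pd_sum (Finset.range N) isOpen_compl_singleton (fun j _ => h.comp_smooth j) i hξ
      have e2 := pd_const_mul isOpen_compl_singleton hs (-1) i hξ
      have e3 := pdIter_add isOpen_compl_singleton h.smooth.contDiffOn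
        (contDiffOn_const (c := (-1 : ℂ)) |>.mul hs) [i] hξ
      simp only [pdIter] at e1 e2 e3
      rw [e3, e2, e1]
    simp only [neg_one_mul, ← sub_eq_add_neg] at h1
    exact h1.symm

theorem isCS_cutoff_mul (hχ : IsCutoff χ) {f : Euc n → ℂ} (hf : IsHomog a f)
    (hs : ContDiffOn ℝ (⊤ : ℕ∞) f {0}ᶜ) :
    IsCS χ a (fun ξ => (χ ξ : ℂ) * f ξ) (fun j ξ => if j = 0 then f ξ else 0) := by
  refine isCS_of_symbolAway hχ (hχ.contDiff_mul hs) (fun j => ?_) (fun j => ?_) fun N => ?_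
  · by_cases hj : j = 0
    · simpa [hj] using hs
    · simpa [hj] using contDiffOn_const
  · by_cases hj : j = 0
    · simpa [hj] using hf
    · simpa [hj] using isHomog_zero _
  · rcases Nat.eq_zero_or_pos N with rfl | hN
    · simpa using (SymbolAway.of_isHomog hf hs).of_eqOn (hχ.contDiff_mul hs).contDiffOn
        (hχ.mul_eqOn f)
    · have hsum : ∀ ξ, ∑ j ∈ Finset.range N, (if j = 0 then f ξ else 0) = f ξ := fun ξ => by
        simp [hN.ne']
      simp only [hsum]
      refine SymbolAway.of_eq_zero ((hχ.contDiff_mul hs).contDiffOn.sub hs) fun ξ hξ => ?_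
      rw [show (χ ξ : ℂ) * f ξ = f ξ from hχ.mul_eqOn f hξ, sub_self]

theorem IsSmoothing.isCS {f : Euc n → ℂ} (hf : IsSmoothing f) (χ : Euc n → ℝ) :
    IsCS χ 0 f (fun _ _ => 0) where
  smooth := hf.1
  comp_smooth _ := contDiffOn_const
  comp_homog j := isHomog_zero _
  estimate N L := by
    obtain ⟨C, hC0, hC⟩ := hf.2 L (N + L.length + 1) (by positivity)
    refine ⟨C, hC0, fun ξ => ?_⟩
    simp only [mul_zero, Finset.sum_const_zero, sub_zero]
    refine (hC ξ).trans ?_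
    gcongr
    · linarith [norm_nonneg ξ]
    · rw [zero_re]
      linarith

theorem isSmoothing_of_eq_zero {f : Euc n → ℂ} (hs : ContDiff ℝ (⊤ : ℕ∞) f)
    (h : ∀ ξ, 1 < ‖ξ‖ → f ξ = 0) : IsSmoothing f := by
  refine ⟨hs, fun L M _ => ?_⟩
  obtain ⟨C, hC0, hC⟩ :=
    (SymbolAway.of_eq_zero (m := L.length - M) hs.contDiffOn h).estimate hs L
  exact ⟨C, hC0, fun ξ => by simpa using hC ξ⟩

theorem IsCS.remainder (hχ : IsCutoff χ) (h : IsCS χ a σ σc) (N : ℕ) :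
    IsCS χ (a - N) (fun ξ => σ ξ - ∑ j ∈ Finset.range N, (χ ξ : ℂ) * σc j ξ)
      (fun j => σc (N + j)) where
  smooth := hχ.contDiff_sub_sum h.smooth h.comp_smooth N
  comp_smooth j := h.comp_smooth _
  comp_homog j := by
    have := h.comp_homog (N + j)
    push_cast [← sub_sub] at this
    exact this
  estimate M L := by
    have := h.estimate (N + M) L
    simp only [Finset.sum_range_add, ← sub_sub, Nat.cast_add] at this
    simpa using this

end ClassicalSymbols

section SingularForms

variable {n : ℕ} {χ : Euc n → ℝ} {a : ℂ}

/-- A linear form on functions which vanishes on smoothing symbols and on partial derivatives of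
classical symbols. -/
structure IsClosedSingular (χ : Euc n → ℝ) (l : (Euc n → ℂ) →ₗ[ℂ] ℂ) : Prop where
  smoothing : ∀ f, IsSmoothing f → l f = 0
  stokes : ∀ a τ τc i, IsCS χ a τ τc → l (pd i τ) = 0

namespace IsClosedSingular

variable {l : (Euc n → ℂ) →ₗ[ℂ] ℂ}

theorem eq_of_eqOn (hl : IsClosedSingular χ l) {f g : Euc n → ℂ}
    (hf : ContDiff ℝ (⊤ : ℕ∞) f) (hg : ContDiff ℝ (⊤ : ℕ∞) g)
    (h : Set.EqOn f g {ξ | 1 < ‖ξ‖}) : l f = l g := by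
  rw [← sub_eq_zero, ← map_sub]
  exact hl.smoothing _ (isSmoothing_of_eq_zero (hf.sub hg) fun ξ hξ => by simp [h hξ])

theorem cutoff_mul_pd (hl : IsClosedSingular χ l) (hχ : IsCutoff χ) {g : Euc n → ℂ}
    {gc : ℕ → Euc n → ℂ} (hg : ContDiffOn ℝ (⊤ : ℕ∞) g {0}ᶜ)
    (h : IsCS χ a (fun ξ => (χ ξ : ℂ) * g ξ) gc) (i : Fin n) :
    l (fun ξ => (χ ξ : ℂ) * pd i g ξ) = 0 := by
  rw [← hl.stokes a _ gc i h]
  exact hl.eq_of_eqOn (hχ.contDiff_mul (hg.pd isOpen_compl_singleton i)) (h.smooth.pd i)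
    ((hχ.mul_eqOn _).trans (eqOn_pd (isOpen_norm_gt 1) (hχ.mul_eqOn g) i).symm)

theorem cutoff_mul_eq_zero (hl : IsClosedSingular χ l) (hχ : IsCutoff χ) {f : Euc n → ℂ}
    {g : Fin n → Euc n → ℂ} {gc : Fin n → ℕ → Euc n → ℂ}
    (hg : ∀ i, ContDiffOn ℝ (⊤ : ℕ∞) (g i) {0}ᶜ)
    (h : ∀ i, IsCS χ a (fun ξ => (χ ξ : ℂ) * g i ξ) (gc i))
    (hf : ∀ ξ, ξ ≠ 0 → f ξ = ∑ i, pd i (g i) ξ) :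
    l (fun ξ => (χ ξ : ℂ) * f ξ) = 0 := by
  have hs : ContDiffOn ℝ (⊤ : ℕ∞) f {0}ᶜ :=
    (ContDiffOn.sum fun i _ => (hg i).pd isOpen_compl_singleton i).congr hf
  have h1 : l (∑ i, fun ξ => (χ ξ : ℂ) * pd i (g i) ξ) = 0 := by
    rw [map_sum]
    exact Finset.sum_eq_zero fun i _ => hl.cutoff_mul_pd hχ (hg i) (h i) i
  rw [← h1]
  refine hl.eq_of_eqOn (hχ.contDiff_mul hs) ?_ fun ξ hξ => ?_
  · have : ContDiff ℝ (⊤ : ℕ∞) (fun ξ => ∑ i, (χ ξ : ℂ) * pd i (g i) ξ) :=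
      ContDiff.sum fun i _ => hχ.contDiff_mul ((hg i).pd isOpen_compl_singleton i)
    convert this
    simp
  · simp [hf ξ (norm_gt_subset zero_le_one hξ), Finset.mul_sum]

theorem cutoff_mul_isHomog (hl : IsClosedSingular χ l) (hχ : IsCutoff χ) {d : ℂ} (hd : d ≠ -n)
    {f : Euc n → ℂ} (hf : IsHomog d f) (hs : ContDiffOn ℝ (⊤ : ℕ∞) f {0}ᶜ) :
    l (fun ξ => (χ ξ : ℂ) * f ξ) = 0 := by
  have hs' : ∀ i : Fin n, ContDiffOn ℝ (⊤ : ℕ∞) (fun ξ => coordFun i ξ * f ξ) {0}ᶜ := fun i =>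
    (contDiff_coordFun i).contDiffOn.mul hs
  have hd' : d + n ≠ 0 := fun h => hd (eq_neg_of_add_eq_zero_left h)
  refine hl.cutoff_mul_eq_zero hχ (a := 1 + d)
    (g := fun i ξ => (d + n)⁻¹ * (coordFun i ξ * f ξ)) (fun i => contDiffOn_const.mul (hs' i))
    (fun i => isCS_cutoff_mul hχ (((isHomog_coordFun i).mul hf).const_mul _)
      (contDiffOn_const.mul (hs' i))) fun ξ hξ => ?_
  have h1 : ∀ i : Fin n, pd i (fun ξ => (d + n)⁻¹ * (coordFun i ξ * f ξ)) ξ =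
      (d + n)⁻¹ * (f ξ + coordFun i ξ * pd i f ξ) := fun i => by
    have e1 := pd_const_mul isOpen_compl_singleton (hs' i) (d + n)⁻¹ i hξ
    have e2 := pd_mul isOpen_compl_singleton (contDiff_coordFun i).contDiffOn hs i hξ
    simp only [pd_coordFun, one_mul] at e1 e2
    rw [e1, e2]
  simp only [h1, ← Finset.mul_sum, Finset.sum_add_distrib, hf.euler hs hξ]
  simp only [Finset.sum_const, Finset.card_univ, Fintype.card_fin, nsmul_eq_mul]
  field_simp
  ring

end IsClosedSingular

end SingularForms

section TailIntegrals

variable {n : ℕ}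

theorem contDiffOn_comp_smul {f : Euc n → ℂ} (hf : ContDiffOn ℝ (⊤ : ℕ∞) f {0}ᶜ) {s : ℝ}
    (hs : s ≠ 0) : ContDiffOn ℝ (⊤ : ℕ∞) (fun ξ => f (s • ξ)) {0}ᶜ :=
  hf.comp (contDiff_const_smul s).contDiffOn fun _ hξ => smul_ne_zero hs hξ

theorem pd_pow_mul_comp_smul {f : Euc n → ℂ} {U : Set (Euc n)} (hU : IsOpen U) {s : ℝ}
    (hf : ContDiffOn ℝ (⊤ : ℕ∞) (fun ξ => f (s • ξ)) U) (k : ℕ) (i : Fin n) :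
    Set.EqOn (pd i (fun ξ => (s : ℂ) ^ k * f (s • ξ)))
      (fun ξ => (s : ℂ) ^ (k + 1) * pd i f (s • ξ)) U := fun ξ hξ => by
  refine (pd_const_mul hU hf ((s : ℂ) ^ k) i hξ).trans ?_
  simp only [pd_comp_smul]
  ring

/-- The weighted integral of `f` over the part of the ray through `ξ` lying beyond `ξ`. -/
def tailInt (k : ℕ) (f : Euc n → ℂ) (ξ : Euc n) : ℂ :=
  ∫ s in Set.Ioi (1 : ℝ), (s : ℂ) ^ k * f (s • ξ)

/-- The parametrised functions `s ↦ s ^ k * f (s • ξ)` whose tail integrals converge. -/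
def IsTailFamily (Φ : ℝ → Euc n → ℂ) : Prop :=
  ∃ (k : ℕ) (m : ℝ) (f : Euc n → ℂ), SymbolAway m f ∧ k + m < -1 ∧
    Φ = fun (s : ℝ) ξ => (s : ℂ) ^ k * f (s • ξ)

theorem SymbolAway.norm_pow_mul_le {m : ℝ} {f : Euc n → ℂ} (hf : SymbolAway m f) {r : ℝ}
    (hr : 0 < r) (k : ℕ) : ∃ C ≥ 0, ∀ s : ℝ, 1 < s → ∀ ξ : Euc n, r < ‖ξ‖ →
      ‖(s : ℂ) ^ k * f (s • ξ)‖ ≤ C * ‖ξ‖ ^ m * s ^ (k + m) := by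
  obtain ⟨C, hC⟩ := hf.bound r hr []
  refine ⟨|C|, abs_nonneg C, fun s hs ξ hξ => ?_⟩
  have hs0 : 0 < s := one_pos.trans hs
  have hn : ‖s • ξ‖ = s * ‖ξ‖ := by rw [norm_smul, Real.norm_of_nonneg hs0.le]
  have h1 := hC (s • ξ) (by rw [hn]; nlinarith [norm_nonneg ξ])
  simp only [pdIter, List.length_nil, Nat.cast_zero, sub_zero, hn,
    Real.mul_rpow hs0.le (norm_nonneg ξ)] at h1
  rw [norm_mul, norm_pow, Complex.norm_real, Real.norm_of_nonneg hs0.le, Real.rpow_add hs0,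
    Real.rpow_natCast]
  calc s ^ k * ‖f (s • ξ)‖ ≤ s ^ k * (|C| * (s ^ m * ‖ξ‖ ^ m)) := by
        gcongr
        refine h1.trans ?_
        gcongr
        exact le_abs_self C
    _ = _ := by ring

theorem isDominatedFamily_tail :
    IsDominatedFamily (volume.restrict (Set.Ioi (1 : ℝ))) {(0 : Euc n)}ᶜ IsTailFamily where
  meas := by
    rintro _ ⟨k, m, f, hf, -, rfl⟩ ξ hξ
    refine ContinuousOn.aestronglyMeasurable ?_ measurableSet_Ioi
    refine ContinuousOn.mul (by fun_prop) (hf.smooth.continuousOn.comp (by fun_prop) ?_)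
    exact fun s hs => smul_ne_zero (one_pos.trans hs).ne' hξ
  diff := by
    rintro _ ⟨k, m, f, hf, -, rfl⟩
    filter_upwards [ae_restrict_mem measurableSet_Ioi] with s hs
    exact (contDiffOn_const.mul (contDiffOn_comp_smul hf.smooth
      (one_pos.trans hs).ne')).differentiableOn (by simp)
  pd_mem := by
    rintro _ ⟨k, m, f, hf, hk, rfl⟩ i
    refine ⟨_, ⟨k + 1, m - 1, pd i f, hf.map_pd i, by push_cast; linarith, rfl⟩, ?_⟩
    filter_upwards [ae_restrict_mem measurableSet_Ioi] with s hs
    exact pd_pow_mul_comp_smul isOpen_compl_singleton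
      (contDiffOn_comp_smul hf.smooth (one_pos.trans hs).ne') k i
  dom := by
    rintro _ ⟨k, m, f, hf, hk, rfl⟩ ξ hξ
    have hpos : 0 < ‖ξ‖ := norm_pos_iff.2 hξ
    obtain ⟨C, hC0, hC⟩ := hf.norm_pow_mul_le (half_pos hpos) k
    refine ⟨_, (isOpen_norm_gt (‖ξ‖ / 2)).mem_nhds (half_lt_self hpos),
      fun s => C * (‖ξ‖ / 2) ^ m * s ^ (k + m),
      (integrableOn_Ioi_rpow_of_lt hk one_pos).const_mul _, ?_⟩
    filter_upwards [ae_restrict_mem measurableSet_Ioi] with s hs η hη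
    refine (hC s hs η hη).trans ?_
    have hs0 : (0 : ℝ) < s := one_pos.trans hs
    have hm : m ≤ 0 := by linarith [(Nat.cast_nonneg k : (0 : ℝ) ≤ k)]
    gcongr C * ?_ * _
    exact Real.rpow_le_rpow_of_nonpos (half_pos hpos) (le_of_lt hη) hm

namespace SymbolAway

variable {m : ℝ} {f : Euc n → ℂ} {k : ℕ}

theorem integrable_tail (hf : SymbolAway m f) (hk : k + m < -1) {ξ : Euc n} (hξ : ξ ≠ 0) :
    IntegrableOn (fun s : ℝ => (s : ℂ) ^ k * f (s • ξ)) (Set.Ioi 1) :=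
  isDominatedFamily_tail.integrable (Φ := fun (s : ℝ) ξ => (s : ℂ) ^ k * f (s • ξ))
    ⟨k, m, f, hf, hk, rfl⟩ hξ

theorem contDiffOn_tailInt (hf : SymbolAway m f) (hk : k + m < -1) :
    ContDiffOn ℝ (⊤ : ℕ∞) (tailInt k f) {0}ᶜ :=
  isDominatedFamily_tail.contDiffOn isOpen_compl_singleton
    (Φ := fun (s : ℝ) ξ => (s : ℂ) ^ k * f (s • ξ)) ⟨k, m, f, hf, hk, rfl⟩

theorem pd_tailInt (hf : SymbolAway m f) (hk : k + m < -1) (i : Fin n) :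
    Set.EqOn (pd i (tailInt k f)) (tailInt (k + 1) (pd i f)) {0}ᶜ := by
  refine isDominatedFamily_tail.pd_integral isOpen_compl_singleton
    (Φ := fun (s : ℝ) ξ => (s : ℂ) ^ k * f (s • ξ))
    (Ψ := fun (s : ℝ) ξ => (s : ℂ) ^ (k + 1) * pd i f (s • ξ)) ⟨k, m, f, hf, hk, rfl⟩ ?_
  filter_upwards [ae_restrict_mem measurableSet_Ioi] with s hs
  exact pd_pow_mul_comp_smul isOpen_compl_singleton
    (contDiffOn_comp_smul hf.smooth (one_pos.trans hs).ne') k i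

theorem map_pdIter (hf : SymbolAway m f) (L : List (Fin n)) :
    SymbolAway (m - L.length) (pdIter L f) := by
  induction L with
  | nil => simpa [pdIter] using hf
  | cons i L ih => simpa [pdIter, sub_sub] using ih.map_pd i

theorem pdIter_tailInt (hf : SymbolAway m f) (hk : k + m < -1) (L : List (Fin n)) :
    Set.EqOn (pdIter L (tailInt k f)) (tailInt (k + L.length) (pdIter L f)) {0}ᶜ := by
  induction L with
  | nil => exact fun _ _ => rfl
  | cons i L ih =>
    refine (eqOn_pd isOpen_compl_singleton ih i).trans ?_
    exact (hf.map_pdIter L).pd_tailInt (by push_cast; linarith) i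

theorem map_tailInt (hf : SymbolAway m f) (hk : k + m < -1) : SymbolAway m (tailInt k f) where
  smooth := hf.contDiffOn_tailInt hk
  bound r hr L := by
    obtain ⟨C, hC0, hC⟩ := (hf.map_pdIter L).norm_pow_mul_le hr (k + L.length)
    refine ⟨C * ∫ s in Set.Ioi (1 : ℝ), s ^ (k + m), fun ξ hξ => ?_⟩
    rw [hf.pdIter_tailInt hk L (norm_gt_subset hr.le hξ), tailInt, mul_right_comm,
      ← integral_const_mul]
    refine norm_integral_le_of_norm_le ((integrableOn_Ioi_rpow_of_lt hk one_pos).const_mul _) ?_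
    filter_upwards [ae_restrict_mem measurableSet_Ioi] with s hs
    convert hC s hs ξ hξ using 3
    push_cast
    ring

theorem tailInt_euler (hf : SymbolAway m f) (hk : k + 1 + m < 0) {ξ : Euc n} (hξ : ξ ≠ 0) :
    ∑ i, coordFun i ξ * pd i (tailInt k f) ξ + (k + 1) * tailInt k f ξ = -f ξ := by
  have hk' : k + m < -1 := by linarith
  have hderiv : ∀ s ∈ Set.Ici (1 : ℝ), HasDerivAt (fun s : ℝ => (s : ℂ) ^ (k + 1) * f (s • ξ))
      (∑ i, coordFun i ξ * ((s : ℂ) ^ (k + 1) * pd i f (s • ξ)) +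
        (k + 1) * ((s : ℂ) ^ k * f (s • ξ))) s := by
    intro s hs
    have hs0 : s ≠ 0 := (one_pos.trans_le hs).ne'
    have h1 : HasDerivAt (fun s : ℝ => f (s • ξ)) (fderiv ℝ f (s • ξ) ξ) s := by
      have := (hf.smooth.differentiableAt_of_isOpen isOpen_compl_singleton
        (smul_ne_zero hs0 hξ)).hasFDerivAt.comp_hasDerivAt s ((hasDerivAt_id' s).smul_const ξ)
      rw [one_smul] at this
      exact this
    have h2 : HasDerivAt (fun s : ℝ => (s : ℂ) ^ (k + 1)) ((k + 1) * (s : ℂ) ^ k) s := by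
      simpa using (hasDerivAt_pow (k + 1) (s : ℂ)).comp_ofReal
    refine (h2.mul h1).congr_deriv ?_
    rw [fderiv_apply_eq_sum, Finset.mul_sum]
    refine (add_comm _ _).trans (congrArg₂ _ ?_ (mul_assoc _ _ _))
    exact Finset.sum_congr rfl fun i _ => mul_left_comm _ _ _
  have hint : ∀ i, IntegrableOn (fun s : ℝ => (s : ℂ) ^ (k + 1) * pd i f (s • ξ)) (Set.Ioi 1) :=
    fun i => (hf.map_pd i).integrable_tail (by push_cast; linarith) hξ
  have hint' := hf.integrable_tail hk' hξ
  have hlim : Tendsto (fun s : ℝ => (s : ℂ) ^ (k + 1) * f (s • ξ)) atTop (𝓝 0) := by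
    have hpos : 0 < ‖ξ‖ := norm_pos_iff.2 hξ
    obtain ⟨C, -, hC⟩ := hf.norm_pow_mul_le (half_pos hpos) (k + 1)
    have h0 : Tendsto (fun s : ℝ => C * ‖ξ‖ ^ m * s ^ (((k + 1 : ℕ) : ℝ) + m)) atTop (𝓝 0) := by
      have := (tendsto_rpow_neg_atTop (y := -(((k + 1 : ℕ) : ℝ) + m))
        (by push_cast; linarith)).const_mul (C * ‖ξ‖ ^ m)
      simpa only [neg_neg, mul_zero] using this
    refine squeeze_zero_norm' ?_ h0
    filter_upwards [eventually_gt_atTop 1] with s hs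
    exact hC s hs ξ (half_lt_self hpos)
  have hsum := integrable_finsetSum Finset.univ fun i _ => (hint i).const_mul (coordFun i ξ)
  have key := integral_Ioi_of_hasDerivAt_of_tendsto' hderiv
    (hsum.add (hint'.const_mul _)) hlim
  rw [integral_add hsum (hint'.const_mul _), integral_finsetSum _ fun i _ =>
    (hint i).const_mul (coordFun i ξ), integral_const_mul] at key
  simp only [integral_const_mul, ofReal_one, one_pow, one_smul, one_mul, zero_sub] at key
  rw [← key]
  congr 1
  exact Finset.sum_congr rfl fun i _ => by rw [hf.pd_tailInt hk' i hξ, tailInt]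

end SymbolAway

theorem IsHomog.tailInt_eq {d : ℂ} {f : Euc n → ℂ} (hf : IsHomog d f) {k : ℕ}
    (hk : k + d.re < -1) {ξ : Euc n} (hξ : ξ ≠ 0) :
    tailInt k f ξ = -(k + 1 + d)⁻¹ * f ξ := by
  have h1 : tailInt k f ξ = ∫ s in Set.Ioi (1 : ℝ), (s : ℂ) ^ (k + d) * f ξ := by
    refine setIntegral_congr_fun measurableSet_Ioi fun s hs => ?_
    have hs0 : (0 : ℝ) < s := one_pos.trans hs
    simp only [hf s hs0 ξ hξ, Complex.cpow_add _ _ (ofReal_ne_zero.2 hs0.ne'), cpow_natCast,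
      mul_assoc]
  rw [h1, integral_mul_const, integral_Ioi_cpow_of_lt (by simpa using hk) one_pos]
  simp only [ofReal_one, one_cpow, neg_div, one_div]
  rw [add_right_comm]

theorem IsClosedSingular.eq_zero_of_re_lt {χ : Euc n → ℝ} {l : (Euc n → ℂ) →ₗ[ℂ] ℂ}
    (hl : IsClosedSingular χ l) (hχ : IsCutoff χ) {k : ℕ} (hk : k + 1 = n) {b : ℂ}
    {σ : Euc n → ℂ} {σc : ℕ → Euc n → ℂ} (h : IsCS χ b σ σc) (hb : b.re < -n) : l σ = 0 := by
  have hkn : (k : ℝ) + 1 = n := by exact_mod_cast hk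
  have hσ : SymbolAway b.re σ := by simpa using h.symbolAway hχ 0
  have hT := hσ.contDiffOn_tailInt (k := k) (by linarith)
  have hg : ∀ i : Fin n,
      ContDiffOn ℝ (⊤ : ℕ∞) (fun ξ => coordFun i ξ * (-1 * tailInt k σ ξ)) {0}ᶜ := fun i =>
    (contDiff_coordFun i).contDiffOn.mul (contDiffOn_const.mul hT)
  have hc : ∀ j : ℕ, SymbolAway (b.re - j) (σc j) := fun j => by
    simpa using SymbolAway.of_isHomog (h.comp_homog j) (h.comp_smooth j)
  have hlin : ∀ N : ℕ, ∀ ξ : Euc n, ξ ≠ 0 →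
      tailInt k (fun ξ => σ ξ - ∑ j ∈ Finset.range N, σc j ξ) ξ =
        tailInt k σ ξ + ∑ j ∈ Finset.range N, (k + 1 + (b - j))⁻¹ * σc j ξ := fun N ξ hξ => by
    have hj : ∀ j : ℕ, k + (b.re - j) < -1 := fun j => by
      linarith [(Nat.cast_nonneg j : (0 : ℝ) ≤ j)]
    have hi := fun j : ℕ => (hc j).integrable_tail (hj j) hξ
    simp only [tailInt, mul_sub, Finset.mul_sum]
    rw [integral_sub (hσ.integrable_tail (by linarith) hξ) (integrable_finsetSum _ fun j _ => hi j),
      integral_finsetSum _ fun j _ => hi j, sub_eq_add_neg, ← Finset.sum_neg_distrib]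
    congr 1
    refine Finset.sum_congr rfl fun j _ => ?_
    have := IsHomog.tailInt_eq (k := k) (h.comp_homog j) (by simpa using hj j) hξ
    rw [tailInt] at this
    rw [this]
    ring
  have hcs : ∀ i : Fin n, IsCS χ (b + 1)
      (fun ξ => (χ ξ : ℂ) * (coordFun i ξ * (-1 * tailInt k σ ξ)))
      (fun j ξ => coordFun i ξ * ((k + 1 + (b - j))⁻¹ * σc j ξ)) := fun i => by
    have hcj := fun j : ℕ => (contDiff_coordFun i).contDiffOn.mul
      ((contDiffOn_const (c := ((k : ℂ) + 1 + (b - j))⁻¹)).mul (h.comp_smooth j))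
    refine isCS_of_symbolAway hχ (hχ.contDiff_mul (hg i)) hcj (fun j => ?_) fun N => ?_
    · have := (isHomog_coordFun i).mul (IsHomog.const_mul (h.comp_homog j) (k + 1 + (b - j))⁻¹)
      rwa [show 1 + (b - j) = b + 1 - j by ring] at this
    · have h1 : SymbolAway 1 (coordFun i) := by
        simpa using SymbolAway.of_isHomog (isHomog_coordFun i) (contDiff_coordFun i).contDiffOn
      have h2 := h1.mul (((h.symbolAway hχ N).map_tailInt (k := k)
        (by linarith [(Nat.cast_nonneg N : (0 : ℝ) ≤ N)])).const_mul (-1))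
      rw [show 1 + (b.re - N) = (b + 1).re - N by simp; ring] at h2
      refine h2.of_eqOn ((hχ.contDiff_mul (hg i)).contDiffOn.sub
        (ContDiffOn.sum fun j _ => hcj j)) fun ξ hξ => ?_
      simp only [hlin N ξ (norm_gt_subset zero_le_one hξ), hχ.one_far ξ (le_of_lt hξ),
        ← Finset.mul_sum, ofReal_one]
      ring
  rw [← hl.cutoff_mul_eq_zero (f := σ) hχ hg hcs fun ξ hξ => ?_]
  · exact hl.eq_of_eqOn h.smooth (hχ.contDiff_mul h.smooth.contDiffOn) (hχ.mul_eqOn σ).symm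
  · have h1 : ∀ i, pd i (fun ξ => coordFun i ξ * (-1 * tailInt k σ ξ)) ξ =
        -(tailInt k σ ξ + coordFun i ξ * pd i (tailInt k σ) ξ) := fun i => by
      have e1 := pd_mul isOpen_compl_singleton (contDiff_coordFun i).contDiffOn
        ((contDiffOn_const (c := (-1 : ℂ))).mul hT) i hξ
      have e2 := pd_const_mul isOpen_compl_singleton hT (-1) i hξ
      simp only [pd_coordFun] at e1 e2
      rw [e1, e2]
      ring
    have h2 := hσ.tailInt_euler (k := k) (by linarith) hξ
    simp only [h1, Finset.sum_neg_distrib, Finset.sum_add_distrib, Finset.sum_const,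
      Finset.card_univ, Fintype.card_fin, nsmul_eq_mul]
    have hkn' : (n : ℂ) = k + 1 := by exact_mod_cast hk.symm
    rw [hkn']
    linear_combination h2

end TailIntegrals

section TestFunctions

variable {n : ℕ}

/-- Smooth functions with compact support. -/
structure IsTest (h : Euc n → ℂ) : Prop where
  smooth : ContDiff ℝ (⊤ : ℕ∞) h
  compact : HasCompactSupport h

namespace IsTest

variable {f g h : Euc n → ℂ}

theorem add (hf : IsTest f) (hg : IsTest g) : IsTest (fun x => f x + g x) :=
  ⟨hf.smooth.add hg.smooth, hf.compact.add hg.compact⟩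

theorem const_mul (hf : IsTest f) (c : ℂ) : IsTest (fun x => c * f x) :=
  ⟨contDiff_const.mul hf.smooth, hf.compact.mul_left⟩

theorem sum {ι : Type*} (s : Finset ι) {F : ι → Euc n → ℂ} (hF : ∀ j, IsTest (F j)) :
    IsTest (fun x => ∑ j ∈ s, F j x) := by
  induction s using Finset.induction_on with
  | empty => exact ⟨by simpa using contDiff_const, HasCompactSupport.zero⟩
  | insert j s hj ih =>
    simp only [Finset.sum_insert hj]
    exact (hF j).add ih

theorem map_pd (hf : IsTest f) (i : Fin n) : IsTest (pd i f) :=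
  ⟨hf.smooth.pd i, hf.compact.fderiv_apply ℝ _⟩

theorem coordFun_mul (hf : IsTest f) (i : Fin n) : IsTest (fun x => coordFun i x * f x) :=
  ⟨(contDiff_coordFun i).mul hf.smooth, hf.compact.mul_left⟩

theorem integrable (hf : IsTest f) : Integrable f :=
  hf.smooth.continuous.integrable_of_hasCompactSupport hf.compact

theorem exists_bound (hf : IsTest f) : ∃ C ≥ 0, ∀ x, ‖f x‖ ≤ C := by
  obtain ⟨C, hC⟩ := hf.compact.exists_bound_of_continuous hf.smooth.continuous
  exact ⟨C, (norm_nonneg _).trans (hC 0), hC⟩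

theorem exists_radius (hf : IsTest f) : ∃ R > 0, ∀ x, R < ‖x‖ → f x = 0 := by
  obtain ⟨R, hR0, hR⟩ := hf.compact.isBounded.exists_pos_norm_le
  exact ⟨R, hR0, fun x hx => by
    by_contra h
    exact absurd (hR x (subset_tsupport _ h)) (not_le.2 hx)⟩

end IsTest

/-- The parametrised functions `(y, t) ↦ w y * h (x - t • y)` of `x`. -/
def IsShiftFamily (w : Euc n → ℂ) (Φ : Euc n × ℝ → Euc n → ℂ) : Prop :=
  ∃ h, IsTest h ∧ Φ = fun p x => w p.1 * h (x - p.2 • p.1)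

theorem pd_comp_sub (h : Euc n → ℂ) (v : Euc n) (i : Fin n) (x : Euc n) :
    pd i (fun x => h (x - v)) x = pd i h (x - v) := by
  simp only [pd, fderiv_comp_sub]

theorem isDominatedFamily_shift {w : Euc n → ℂ} (hw : IsTest w) :
    IsDominatedFamily ((volume : Measure (Euc n)).prod (volume.restrict (Set.Ioc (0 : ℝ) 1)))
      Set.univ (IsShiftFamily w) where
  meas := by
    rintro _ ⟨h, hh, rfl⟩ ξ -
    have := hw.smooth.continuous
    have := hh.smooth.continuous
    exact Continuous.aestronglyMeasurable (by fun_prop)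
  diff := by
    rintro _ ⟨h, hh, rfl⟩
    refine Eventually.of_forall fun p => ?_
    have := hh.smooth.differentiable (by simp)
    exact Differentiable.differentiableOn (by fun_prop)
  pd_mem := by
    rintro _ ⟨h, hh, rfl⟩ i
    refine ⟨_, ⟨pd i h, hh.map_pd i, rfl⟩, Eventually.of_forall fun p x hx => ?_⟩
    refine (pd_const_mul isOpen_univ (contDiffOn_univ.2 (hh.smooth.comp
      (contDiff_id.sub contDiff_const))) (w p.1) i hx).trans ?_
    exact congrArg _ (pd_comp_sub h _ i x)
  dom := by
    rintro _ ⟨h, hh, rfl⟩ ξ -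
    obtain ⟨C, -, hC⟩ := hh.exists_bound
    refine ⟨_, univ_mem, fun p => ‖w p.1‖ * C, hw.integrable.norm.mul_prod
      (integrable_const C), Eventually.of_forall fun p x _ => ?_⟩
    rw [norm_mul]
    exact mul_le_mul_of_nonneg_left (hC _) (norm_nonneg _)

/-- The average of the translates of `h` by `t • y`, weighted by `w y`. -/
def shiftInt (w h : Euc n → ℂ) (x : Euc n) : ℂ :=
  ∫ p : Euc n × ℝ, w p.1 * h (x - p.2 • p.1)
    ∂(volume.prod (volume.restrict (Set.Ioc (0 : ℝ) 1)))

theorem isTest_shiftInt {w h : Euc n → ℂ} (hw : IsTest w) (hh : IsTest h) :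
    IsTest (shiftInt w h) where
  smooth := contDiffOn_univ.1 ((isDominatedFamily_shift hw).contDiffOn isOpen_univ
    (Φ := fun p x => w p.1 * h (x - p.2 • p.1)) ⟨h, hh, rfl⟩)
  compact := by
    obtain ⟨R, hR0, hR⟩ := hw.exists_radius
    obtain ⟨S, hS0, hS⟩ := hh.exists_radius
    refine HasCompactSupport.intro (isCompact_closedBall 0 (R + S)) fun x hx => ?_
    refine integral_eq_zero_of_ae ?_
    have hae : ∀ᵐ p ∂((volume : Measure (Euc n)).prod (volume.restrict (Set.Ioc (0 : ℝ) 1))),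
        p.2 ∈ Set.Ioc (0 : ℝ) 1 :=
      Measure.quasiMeasurePreserving_snd.ae (ae_restrict_mem measurableSet_Ioc)
    filter_upwards [hae] with p hp
    by_cases hpR : R < ‖p.1‖
    · simp [hR _ hpR]
    · have h1 : ‖p.2 • p.1‖ ≤ R := by
        rw [norm_smul, Real.norm_of_nonneg hp.1.le]
        exact (mul_le_of_le_one_left (norm_nonneg _) hp.2).trans (not_lt.1 hpR)
      have h2 : S < ‖x - p.2 • p.1‖ := by
        rw [mem_closedBall_zero_iff, not_le] at hx
        linarith [norm_sub_norm_le x (p.2 • p.1)]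
      simp [hS _ h2]

theorem pd_shiftInt {w h : Euc n → ℂ} (hw : IsTest w) (hh : IsTest h) (i : Fin n) (x : Euc n) :
    pd i (shiftInt w h) x = shiftInt w (pd i h) x := by
  refine (isDominatedFamily_shift hw).pd_integral isOpen_univ
    (Φ := fun p x => w p.1 * h (x - p.2 • p.1))
    (Ψ := fun p x => w p.1 * pd i h (x - p.2 • p.1)) ⟨h, hh, rfl⟩
    (Eventually.of_forall fun p x hx => ?_) (Set.mem_univ x)
  refine (pd_const_mul isOpen_univ (contDiffOn_univ.2 (hh.smooth.comp
    (contDiff_id.sub contDiff_const))) (w p.1) i hx).trans ?_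
  exact congrArg _ (pd_comp_sub h _ i x)

theorem integral_mul_comp_sub {w h : Euc n → ℂ} (hw : IsTest w) (hh : IsTest h) (x : Euc n) :
    ∫ y, w y * h (x - y) = (∫ y, w y) * h x +
      -1 * ∑ i, pd i (shiftInt (fun y => coordFun i y * w y) h) x := by
  have hi : ∀ i, Integrable (fun p : Euc n × ℝ => coordFun i p.1 * w p.1 *
      pd i h (x - p.2 • p.1)) (volume.prod (volume.restrict (Set.Ioc (0 : ℝ) 1))) := fun i =>
    (isDominatedFamily_shift (hw.coordFun_mul i)).integrable
      (Φ := fun p x => coordFun i p.1 * w p.1 * pd i h (x - p.2 • p.1))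
      ⟨_, hh.map_pd i, rfl⟩ (Set.mem_univ x)
  have hftc : ∀ y, ∫ t in Set.Ioc (0 : ℝ) 1,
      ∑ i, coordFun i y * w y * pd i h (x - t • y) = w y * h x - w y * h (x - y) := by
    intro y
    have hd : ∀ t : ℝ, HasDerivAt (fun t : ℝ => -(w y * h (x - t • y)))
        (∑ i, coordFun i y * w y * pd i h (x - t • y)) t := fun t => by
      have h1 := (hh.smooth.differentiable (by simp) (x - t • y)).hasFDerivAt.comp_hasDerivAt t
        (((hasDerivAt_id' t).smul_const y).const_sub x)
      refine (h1.const_mul (w y)).neg.congr_deriv ?_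
      rw [one_smul, map_neg, mul_neg, neg_neg, fderiv_apply_eq_sum, Finset.mul_sum]
      exact Finset.sum_congr rfl fun i _ => by ring
    have hc : Continuous fun t : ℝ => ∑ i, coordFun i y * w y * pd i h (x - t • y) :=
      continuous_finsetSum _ fun i _ => continuous_const.mul
        ((hh.map_pd i).smooth.continuous.comp (by fun_prop))
    rw [← intervalIntegral.integral_of_le zero_le_one,
      intervalIntegral.integral_eq_sub_of_hasDerivAt (fun t _ => hd t)
        (hc.intervalIntegrable 0 1)]
    simp
    ring
  have h1 : Integrable fun y => w y * h (x - y) := by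
    refine Continuous.integrable_of_hasCompactSupport ?_ hw.compact.mul_right
    have := hw.smooth.continuous
    have := hh.smooth.continuous
    fun_prop
  have h2 : ∑ i, pd i (shiftInt (fun y => coordFun i y * w y) h) x =
      (∫ y, w y) * h x - ∫ y, w y * h (x - y) := by
    simp only [pd_shiftInt (hw.coordFun_mul _) hh, shiftInt]
    rw [← integral_finsetSum _ fun i _ => hi i, integral_prod _ (integrable_finsetSum _
      fun i _ => hi i)]
    simp only [hftc]
    rw [integral_sub (hw.integrable.mul_const _) h1, integral_mul_const]
  rw [h2]
  ring

/-- A linear functional on test functions which vanishes on all partial derivatives is a multiple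
of the integral. -/
theorem exists_eq_mul_integral (Λ : (Euc n → ℂ) → ℂ)
    (hadd : ∀ f g, IsTest f → IsTest g → Λ (fun x => f x + g x) = Λ f + Λ g)
    (hmul : ∀ (c : ℂ) f, IsTest f → Λ (fun x => c * f x) = c * Λ f)
    (hpd : ∀ i f, IsTest f → Λ (pd i f) = 0) :
    ∃ c : ℂ, ∀ h, IsTest h → Λ h = c * ∫ x, h x := by
  have hsum : ∀ (s : Finset (Fin n)) (F : Fin n → Euc n → ℂ), (∀ i, IsTest (F i)) →
      Λ (fun x => ∑ i ∈ s, pd i (F i) x) = 0 := fun s F hF => by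
    induction s using Finset.induction_on with
    | empty =>
      have h0 : IsTest (fun _ : Euc n => (0 : ℂ)) := ⟨contDiff_const, HasCompactSupport.zero⟩
      simpa using hmul 0 _ h0
    | insert j s hj ih =>
      simp only [Finset.sum_insert hj]
      rw [hadd _ _ ((hF j).map_pd j) (IsTest.sum s fun i => (hF i).map_pd i), hpd j _ (hF j), ih,
        add_zero]
  have key : ∀ w h, IsTest w → IsTest h →
      Λ (fun x => ∫ y, w y * h (x - y)) = (∫ y, w y) * Λ h := fun w h hw hh => by
    have ht : ∀ i, IsTest (shiftInt (fun y => coordFun i y * w y) h) := fun i =>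
      isTest_shiftInt (hw.coordFun_mul i) hh
    have ht' := IsTest.sum Finset.univ fun i => (ht i).map_pd i
    simp only [integral_mul_comp_sub hw hh]
    rw [hadd _ _ (hh.const_mul _) (ht'.const_mul _), hmul _ _ hh, hmul _ _ ht', hsum _ _ ht,
      mul_zero, add_zero]
  let φ : ContDiffBump (0 : Euc n) := ⟨1, 2, one_pos, one_lt_two⟩
  have hθ : IsTest (fun x : Euc n => ((φ.normed volume x : ℝ) : ℂ)) :=
    ⟨Complex.ofRealCLM.contDiff.comp φ.contDiff_normed,
      φ.hasCompactSupport_normed.comp_left ofReal_zero⟩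
  refine ⟨Λ (fun x => ((φ.normed volume x : ℝ) : ℂ)), fun h hh => ?_⟩
  have h1 := key _ _ hθ hh
  have h2 := key _ _ hh hθ
  have h3 : ∀ x, ∫ y, h y * ((φ.normed volume (x - y) : ℝ) : ℂ) =
      ∫ y, ((φ.normed volume y : ℝ) : ℂ) * h (x - y) := fun x => by
    rw [← integral_sub_left_eq_self (fun y => ((φ.normed volume y : ℝ) : ℂ) * h (x - y)) _ x]
    simp only [sub_sub_cancel, mul_comm]
  simp only [h3] at h2
  rw [h1, integral_complex_ofReal, φ.integral_normed, ofReal_one, one_mul] at h2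
  rw [h2, mul_comm]

end TestFunctions

section RayIntegrals

variable {n : ℕ}

/-- The weighted integral of `h` along the ray through `ξ`. -/
def rayInt (k : ℕ) (h : Euc n → ℂ) (ξ : Euc n) : ℂ :=
  ∫ t in Set.Ioi (0 : ℝ), (t : ℂ) ^ k * h (t • ξ)

/-- The parametrised functions `t ↦ t ^ k * h (t • ξ)` for test functions `h`. -/
def IsRayFamily (Φ : ℝ → Euc n → ℂ) : Prop :=
  ∃ (k : ℕ) (h : Euc n → ℂ), IsTest h ∧ Φ = fun (t : ℝ) ξ => (t : ℂ) ^ k * h (t • ξ)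

theorem isDominatedFamily_ray :
    IsDominatedFamily (volume.restrict (Set.Ioi (0 : ℝ))) {(0 : Euc n)}ᶜ IsRayFamily where
  meas := by
    rintro _ ⟨k, h, hh, rfl⟩ ξ -
    have := hh.smooth.continuous
    exact Continuous.aestronglyMeasurable (by fun_prop)
  diff := by
    rintro _ ⟨k, h, hh, rfl⟩
    have := hh.smooth.differentiable (by simp)
    exact Eventually.of_forall fun t => Differentiable.differentiableOn (by fun_prop)
  pd_mem := by
    rintro _ ⟨k, h, hh, rfl⟩ i
    refine ⟨_, ⟨k + 1, pd i h, hh.map_pd i, rfl⟩, Eventually.of_forall fun t => ?_⟩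
    exact pd_pow_mul_comp_smul isOpen_compl_singleton
      (hh.smooth.comp (contDiff_const_smul t)).contDiffOn k i
  dom := by
    rintro _ ⟨k, h, hh, rfl⟩ ξ hξ
    have hpos : 0 < ‖ξ‖ / 2 := half_pos (norm_pos_iff.2 hξ)
    obtain ⟨C, hC0, hC⟩ := hh.exists_bound
    obtain ⟨R, hR0, hR⟩ := hh.exists_radius
    refine ⟨_, (isOpen_norm_gt (‖ξ‖ / 2)).mem_nhds (half_lt_self (norm_pos_iff.2 hξ)),
      (Set.Ioc 0 (R / (‖ξ‖ / 2))).indicator fun _ => (R / (‖ξ‖ / 2)) ^ k * C,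
      ((integrable_indicator_iff measurableSet_Ioc).2 (integrableOn_const
        (by simp))).restrict, ?_⟩
    filter_upwards [ae_restrict_mem measurableSet_Ioi] with t ht η hη
    have ht0 : (0 : ℝ) < t := ht
    by_cases htR : t ≤ R / (‖ξ‖ / 2)
    · rw [Set.indicator_of_mem (Set.mem_Ioc.2 ⟨ht0, htR⟩), norm_mul, norm_pow, Complex.norm_real,
        Real.norm_of_nonneg ht0.le]
      exact mul_le_mul (pow_le_pow_left₀ ht0.le htR k) (hC _) (norm_nonneg _) (by positivity)
    · have h1 : R < ‖t • η‖ := by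
        rw [norm_smul, Real.norm_of_nonneg ht0.le]
        rw [not_le, div_lt_iff₀ hpos] at htR
        exact htR.trans (mul_lt_mul_of_pos_left hη ht0)
      rw [hR _ h1, mul_zero, norm_zero]
      exact Set.indicator_nonneg (fun _ _ => by positivity) _

variable {h : Euc n → ℂ} {k : ℕ}

theorem IsTest.integrable_ray (hh : IsTest h) (k : ℕ) {ξ : Euc n} (hξ : ξ ≠ 0) :
    IntegrableOn (fun t : ℝ => (t : ℂ) ^ k * h (t • ξ)) (Set.Ioi 0) :=
  isDominatedFamily_ray.integrable (Φ := fun (t : ℝ) ξ => (t : ℂ) ^ k * h (t • ξ))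
    ⟨k, h, hh, rfl⟩ hξ

theorem IsTest.contDiffOn_rayInt (hh : IsTest h) (k : ℕ) :
    ContDiffOn ℝ (⊤ : ℕ∞) (rayInt k h) {0}ᶜ :=
  isDominatedFamily_ray.contDiffOn isOpen_compl_singleton
    (Φ := fun (t : ℝ) ξ => (t : ℂ) ^ k * h (t • ξ)) ⟨k, h, hh, rfl⟩

theorem IsTest.pd_rayInt (hh : IsTest h) (k : ℕ) (i : Fin n) :
    Set.EqOn (pd i (rayInt k h)) (rayInt (k + 1) (pd i h)) {0}ᶜ :=
  isDominatedFamily_ray.pd_integral isOpen_compl_singleton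
    (Φ := fun (t : ℝ) ξ => (t : ℂ) ^ k * h (t • ξ))
    (Ψ := fun (t : ℝ) ξ => (t : ℂ) ^ (k + 1) * pd i h (t • ξ)) ⟨k, h, hh, rfl⟩
    (Eventually.of_forall fun t => pd_pow_mul_comp_smul isOpen_compl_singleton
      (hh.smooth.comp (contDiff_const_smul t)).contDiffOn k i)

theorem isHomog_rayInt (k : ℕ) (h : Euc n → ℂ) : IsHomog (-(k + 1)) (rayInt k h) := by
  intro s hs ξ _
  have hs' : (s : ℂ) ≠ 0 := ofReal_ne_zero.2 hs.ne'
  have h1 := integral_comp_mul_left_Ioi (fun t : ℝ => (t : ℂ) ^ k * h (t • ξ)) 0 hs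
  rw [mul_zero] at h1
  simp only [ofReal_mul, mul_pow, mul_assoc, integral_const_mul] at h1
  simp only [rayInt, smul_smul]
  rw [cpow_neg, show (k : ℂ) + 1 = ((k + 1 : ℕ) : ℂ) by push_cast; rfl, cpow_natCast, pow_succ,
    mul_inv, mul_assoc]
  rw [eq_inv_mul_iff_mul_eq₀ (pow_ne_zero _ hs')]
  simpa only [mul_comm, real_smul, ofReal_inv] using h1

theorem integral_eq_integral_sphere (hn : n ≠ 0) {F : Euc n → ℂ} (hF : Integrable F) :
    ∫ x, F x = ∫ ω : sphere (0 : Euc n) 1,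
      (∫ r in Set.Ioi (0 : ℝ), (r : ℂ) ^ (n - 1) * F (r • (ω : Euc n))) ∂(sphMeas n) := by
  have : Nontrivial (Euc n) := by
    have : Nonempty (Fin n) := ⟨⟨0, Nat.pos_of_ne_zero hn⟩⟩
    infer_instance
  have hmp := (volume : Measure (Euc n)).measurePreserving_homeomorphUnitSphereProd
  have hemb := (homeomorphUnitSphereProd (Euc n)).measurableEmbedding
  rw [finrank_euclideanSpace_fin] at hmp
  have hF' : ∀ x : ({0}ᶜ : Set (Euc n)), F ((homeomorphUnitSphereProd (Euc n) x).2.1 •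
      ((homeomorphUnitSphereProd (Euc n) x).1 : Euc n)) = F x := fun x => by
    simp only [homeomorphUnitSphereProd_apply_snd_coe, homeomorphUnitSphereProd_apply_fst_coe]
    rw [smul_inv_smul₀ (norm_ne_zero_iff.2 x.2)]
  have h1 := hmp.integral_comp hemb (fun p => F (p.2.1 • (p.1 : Euc n)))
  have h2 := hmp.integrable_comp_emb hemb (g := fun p => F (p.2.1 • (p.1 : Euc n)))
  simp only [Function.comp_def, hF'] at h1 h2
  rw [integral_subtype_comap (measurableSet_singleton _).compl, restrict_compl_singleton] at h1
  have h3 := h2.1 ((integrableOn_iff_comap_subtypeVal (measurableSet_singleton _).compl).1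
    hF.integrableOn)
  rw [h1, integral_prod _ h3, sphMeas]
  congr 1
  ext ω
  simp only [Measure.volumeIoiPow, ENNReal.ofReal]
  rw [integral_withDensity_eq_integral_smul, integral_subtype_comap measurableSet_Ioi
    fun r => Real.toNNReal (r ^ (n - 1)) • F (r • (ω : Euc n))]
  · refine setIntegral_congr_fun measurableSet_Ioi fun r hr => ?_
    have hr0 : (0 : ℝ) < r := hr
    simp only [NNReal.smul_def, Real.coe_toNNReal _ (pow_nonneg hr0.le _), real_smul, ofReal_pow]
  · exact (measurable_subtype_coe.pow_const _).real_toNNReal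

/-- Integration of test functions in polar coordinates. -/
theorem IsTest.integral_eq_sphInt (hn : n ≠ 0) (hh : IsTest h) :
    ∫ x, h x = sphInt (rayInt (n - 1) h) :=
  integral_eq_integral_sphere hn hh.integrable

/-- Every homogeneous function of degree `-n` is a ray integral of a test function. -/
theorem IsHomog.exists_rayInt_eq (hk : k + 1 = n) {f : Euc n → ℂ} (hf : IsHomog (-n) f)
    (hs : ContDiffOn ℝ (⊤ : ℕ∞) f {0}ᶜ) :
    ∃ h, IsTest h ∧ ∀ ξ, ξ ≠ 0 → rayInt k h ξ = f ξ := by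
  let ψ : ContDiffBump (2 : ℝ) := ⟨1 / 2, 1, by norm_num, by norm_num⟩
  have hψ0 : ∀ t : ℝ, t ∉ ball (2 : ℝ) 1 → ψ.normed volume t = 0 := fun t ht =>
    Function.notMem_support.1 (by rwa [ψ.support_normed_eq])
  refine ⟨fun ξ => ((‖ξ‖ * ψ.normed volume ‖ξ‖ : ℝ) : ℂ) * f ξ, ⟨?_, ?_⟩, fun ξ hξ => ?_⟩
  · rw [contDiff_iff_contDiffAt]
    intro ξ
    by_cases hξ : ξ = 0
    · refine (contDiffAt_const (c := (0 : ℂ))).congr_of_eventuallyEq ?_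
      filter_upwards [ball_mem_nhds ξ one_pos] with η hη
      rw [hξ, mem_ball_zero_iff] at hη
      rw [hψ0 _ fun h => ?_]
      · simp
      · rw [mem_ball, Real.dist_eq, abs_lt] at h
        linarith
    · refine ContDiffAt.mul (Complex.ofRealCLM.contDiff.contDiffAt.comp ξ
        ((contDiffAt_norm ℝ hξ).mul (ψ.contDiff_normed.contDiffAt.comp ξ
          (contDiffAt_norm ℝ hξ)))) ?_
      exact hs.contDiffAt (isOpen_compl_singleton.mem_nhds hξ)
  · refine HasCompactSupport.intro (isCompact_closedBall 0 3) fun ξ hξ => ?_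
    rw [mem_closedBall_zero_iff, not_le] at hξ
    rw [hψ0 _ fun h => ?_]
    · simp
    · rw [mem_ball, Real.dist_eq, abs_lt] at h
      linarith
  · have hpos : 0 < ‖ξ‖ := norm_pos_iff.2 hξ
    have h1 : rayInt k (fun ξ => ((‖ξ‖ * ψ.normed volume ‖ξ‖ : ℝ) : ℂ) * f ξ) ξ =
        ∫ t in Set.Ioi (0 : ℝ), ((‖ξ‖ * ψ.normed volume (t * ‖ξ‖) : ℝ) : ℂ) * f ξ := by
      refine setIntegral_congr_fun measurableSet_Ioi fun t ht => ?_
      have ht0 : (t : ℂ) ≠ 0 := ofReal_ne_zero.2 (ne_of_gt ht)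
      simp only [norm_smul, Real.norm_of_nonneg (le_of_lt ht), hf t ht ξ hξ, cpow_neg,
        cpow_natCast, ← hk, pow_succ, ofReal_mul]
      field_simp
    have h2 : ∫ t in Set.Ioi (0 : ℝ), ψ.normed volume t = 1 := by
      rw [setIntegral_eq_integral_of_forall_compl_eq_zero fun t ht => hψ0 t fun h => ht ?_,
        ψ.integral_normed]
      rw [mem_ball, Real.dist_eq, abs_lt] at h
      exact Set.mem_Ioi.2 (by linarith)
    rw [h1, integral_mul_const, integral_complex_ofReal, integral_const_mul, ← smul_eq_mul ‖ξ‖,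
      integral_comp_mul_right_Ioi' (fun t => ψ.normed volume t) 0 hpos, zero_mul, h2]
    simp

/-- On symbols which are homogeneous of degree `-n` outside a ball, a closed singular linear form
is a multiple of the integral over the unit sphere. -/
theorem IsClosedSingular.exists_eq_mul_sphInt {χ : Euc n → ℝ} {l : (Euc n → ℂ) →ₗ[ℂ] ℂ}
    (hl : IsClosedSingular χ l) (hχ : IsCutoff χ) (hk : k + 2 = n) :
    ∃ c : ℂ, ∀ f : Euc n → ℂ, IsHomog (-n) f → ContDiffOn ℝ (⊤ : ℕ∞) f {0}ᶜ →
      l (fun ξ => (χ ξ : ℂ) * f ξ) = c * sphInt f := by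
  have hχ0 : χ 0 = 0 := by
    obtain ⟨ε, hε, h0⟩ := hχ.zero_near
    exact h0 0 (by simpa using hε)
  have hcongr : ∀ f g : Euc n → ℂ, (∀ ξ, ξ ≠ 0 → f ξ = g ξ) →
      (fun ξ => (χ ξ : ℂ) * f ξ) = fun ξ => (χ ξ : ℂ) * g ξ := fun f g hfg => by
    ext ξ
    by_cases hξ : ξ = 0
    · simp [hξ, hχ0]
    · rw [hfg ξ hξ]
  have key : ∃ c : ℂ, ∀ h : Euc n → ℂ, IsTest h →
      l (fun ξ => (χ ξ : ℂ) * rayInt (k + 1) h ξ) = c * ∫ x, h x := by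
    refine exists_eq_mul_integral
      (fun h : Euc n → ℂ => l (fun ξ => (χ ξ : ℂ) * rayInt (k + 1) h ξ)) ?_ ?_ ?_
    · intro f g hf hg
      rw [← map_add]
      refine congrArg l ((hcongr _ (fun ξ => rayInt (k + 1) f ξ + rayInt (k + 1) g ξ)
        fun ξ hξ => ?_).trans ?_)
      · simp only [rayInt, mul_add]
        exact integral_add (hf.integrable_ray _ hξ) (hg.integrable_ray _ hξ)
      · ext ξ
        simp [mul_add]
    · intro c f _
      rw [← smul_eq_mul c, ← map_smul]
      refine congrArg l ?_
      ext ξ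
      simp only [rayInt, mul_left_comm _ c, integral_const_mul, Pi.smul_apply, smul_eq_mul]
    · intro i f hf
      rw [hcongr _ _ fun ξ hξ => (hf.pd_rayInt k i hξ).symm]
      exact hl.cutoff_mul_pd hχ (hf.contDiffOn_rayInt k)
        (isCS_cutoff_mul hχ (isHomog_rayInt k f) (hf.contDiffOn_rayInt k)) i
  obtain ⟨c, hc⟩ := key
  refine ⟨c, fun f hf hs => ?_⟩
  obtain ⟨h, hh, hfh⟩ := hf.exists_rayInt_eq (k := k + 1) hk hs
  rw [← hcongr _ _ hfh, hc h hh, hh.integral_eq_sphInt (by omega), show n - 1 = k + 1 by omega]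
  exact congrArg _ (integral_congr_ae (Eventually.of_forall fun ω =>
    hfh ω (ne_zero_of_mem_unit_sphere ω)))

end RayIntegrals

/-- A closed singular linear form on the space of all functions is a multiple of the residue on
classical symbols. -/
theorem IsClosedSingular.exists_eq_mul_resCC {n : ℕ} (hn : 2 ≤ n) {χ : Euc n → ℝ}
    (hχ : IsCutoff χ) {l : (Euc n → ℂ) →ₗ[ℂ] ℂ} (hl : IsClosedSingular χ l) :
    ∃ c : ℂ, ∀ (σ : Euc n → ℂ) (a : ℂ) (σc : ℕ → Euc n → ℂ),
      IsCS χ a σ σc → l σ = c * resCC a σc := by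
  obtain ⟨k, rfl⟩ := Nat.exists_eq_add_of_le' hn
  obtain ⟨c, hc⟩ := hl.exists_eq_mul_sphInt hχ rfl
  have hpi : (((2 * Real.pi) ^ (-((k + 2 : ℕ) : ℝ) / 2) : ℝ) : ℂ) ≠ 0 :=
    ofReal_ne_zero.2 (Real.rpow_pos_of_pos Real.two_pi_pos _).ne'
  refine ⟨c / (((2 * Real.pi) ^ (-((k + 2 : ℕ) : ℝ) / 2) : ℝ) : ℂ), fun σ a σc h => ?_⟩
  obtain ⟨N, hN⟩ := exists_nat_gt (a.re + (k + 2 : ℕ))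
  have hrem := hl.eq_zero_of_re_lt hχ (k := k + 1) rfl (h.remainder hχ N) (by
    rw [sub_re, natCast_re]
    linarith)
  have hsplit : l σ = ∑ j ∈ Finset.range N, l (fun ξ => (χ ξ : ℂ) * σc j ξ) := by
    rw [← sub_eq_zero, ← map_sum, ← map_sub, ← hrem]
    congr 1
    ext ξ
    simp
  rw [hsplit, resCC]
  split_ifs with hj
  · have hj' := hj.choose_spec
    generalize hj.choose = j at hj'
    have hjN : j < N := by
      have := congrArg re hj'
      simp only [sub_re, natCast_re, neg_re] at this
      exact_mod_cast (by linarith : (j : ℝ) < N)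
    have hh : IsHomog (-((k + 2 : ℕ) : ℂ)) (σc j) := hj' ▸ h.comp_homog j
    rw [Finset.sum_eq_single_of_mem j (Finset.mem_range.2 hjN) fun i _ hi => ?_,
      hc _ hh (h.comp_smooth j), div_mul_eq_mul_div, mul_left_comm, mul_div_cancel_left₀ _ hpi]
    refine hl.cutoff_mul_isHomog hχ (fun hd => hi ?_) (h.comp_homog i) (h.comp_smooth i)
    exact_mod_cast sub_right_injective (hd.trans hj'.symm)
  · rw [mul_zero]
    exact Finset.sum_eq_zero fun i _ => hl.cutoff_mul_isHomog hχ
      (fun hd => hj ⟨i, hd⟩) (h.comp_homog i) (h.comp_smooth i)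

/-- **Uniqueness of the noncommutative residue**: any singular linear form on
`CS_{c.c}(ℝⁿ)` with Stokes' property is proportional to the residue. -/
theorem res_unique {n : ℕ} (hn : 2 ≤ n) {χ : Euc n → ℝ} (hχ : IsCutoff χ)
    (ρ : CSspan n χ →ₗ[ℂ] ℂ)
    (hsing : ∀ σ : CSspan n χ, IsSmoothing (σ : Euc n → ℂ) → ρ σ = 0)
    (hstokes : ∀ (τ σ : CSspan n χ) (i : Fin n),
      (σ : Euc n → ℂ) = pd i (τ : Euc n → ℂ) → ρ σ = 0) :
    ∃ c : ℂ, ∀ (σ : CSspan n χ) (a : ℂ) (σc : ℕ → Euc n → ℂ),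
      IsCS χ a (σ : Euc n → ℂ) σc → ρ σ = c * resCC a σc := by
  obtain ⟨l, hl⟩ := ρ.exists_extend
  have hlρ : ∀ σ : CSspan n χ, l σ = ρ σ := fun σ => LinearMap.congr_fun hl σ
  have hmem : ∀ {a : ℂ} {σ : Euc n → ℂ} {σc : ℕ → Euc n → ℂ}, IsCS χ a σ σc → σ ∈ CSspan n χ :=
    fun h => Submodule.subset_span ⟨_, _, h⟩
  have hcl : IsClosedSingular χ l :=
    { smoothing := fun f hf =>
        (hlρ ⟨f, hmem (hf.isCS χ)⟩).trans (hsing ⟨f, hmem (hf.isCS χ)⟩ hf)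
      stokes := fun a τ τc i h =>
        (hlρ ⟨pd i τ, hmem (h.map_pd hχ i)⟩).trans
          (hstokes ⟨τ, hmem h⟩ ⟨pd i τ, hmem (h.map_pd hχ i)⟩ i rfl) }
  obtain ⟨c, hc⟩ := hcl.exists_eq_mul_resCC hn hχ
  exact ⟨c, fun σ a σc h => (hlρ σ).symm.trans (hc σ a σc h)⟩

end
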